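/- arXiv:2106.06447 — 2 statements merged into one kernel-verified Lean document; each statement's English description precedes it below -/
import Mathlib

section
/- Let f: (0,∞) → (0,∞) be a function such that a := lim_{t→∞} log(f(t))/t exists in ℝ and such that limsup_{t→∞} f(t)e^{−at} < ∞. Then liminf_{t→∞} f(t)e^{−at} > 0 if and only if limsup_{t→∞} f(2t)/f(t)² < ∞. -/
/- Statement 13 (Lemma `Lemma: limsup of quotient`): Let `f : (0,∞) → (0,∞)` be such that
`a := lim_{t→∞} log(f(t))/t` exists in `ℝ` and `limsup_{t→∞} f(t)e^{−at} < ∞`. Then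
`liminf_{t→∞} f(t)e^{−at} > 0` if and only if `limsup_{t→∞} f(2t)/f(t)² < ∞`. -/

open Filter
open scoped ENNReal Topology

theorem liminf_pos_iff_limsup_quotient_lt_top
    (f : ℝ → ℝ) (hf : ∀ t : ℝ, 0 < t → 0 < f t)
    (a : ℝ)
    (ha : Tendsto (fun t : ℝ => Real.log (f t) / t) atTop (𝓝 a))
    (hsup : limsup (fun t : ℝ => ENNReal.ofReal (f t * Real.exp (-(a * t)))) atTop < ∞) :
    (0 < liminf (fun t : ℝ => ENNReal.ofReal (f t * Real.exp (-(a * t)))) atTop) ↔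
      limsup (fun t : ℝ => ENNReal.ofReal (f (2 * t) / f t ^ 2)) atTop < ∞ := by
  have hpos : ∀ t : ℝ, 0 < t → 0 < f t * Real.exp (-(a * t)) := fun t ht =>
    mul_pos (hf t ht) (Real.exp_pos _)
  constructor
  · intro hinf
    obtain ⟨C, hC1, hC2⟩ := exists_between hsup
    obtain ⟨c, hc1, hc2⟩ := exists_between hinf
    have h1 := eventually_lt_of_limsup_lt hC1
    have h2 := eventually_lt_of_lt_liminf hc2
    have hct : c ≠ ∞ := ne_top_of_lt hc2
    have hc0 : 0 < c.toReal := ENNReal.toReal_pos hc1.ne' hct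
    have h3 : Tendsto (fun t : ℝ => 2 * t) atTop atTop :=
      tendsto_id.const_mul_atTop (by norm_num)
    refine lt_of_le_of_lt (limsup_le_of_le (a := ENNReal.ofReal (C.toReal / c.toReal ^ 2)) (by isBoundedDefault) ?_)
      ENNReal.ofReal_lt_top
    filter_upwards [h3.eventually h1, h2, eventually_gt_atTop 0] with t hu hl ht
    apply ENNReal.ofReal_le_ofReal
    have hu' : f (2 * t) * Real.exp (-(a * (2 * t))) ≤ C.toReal :=
      (ENNReal.ofReal_le_iff_le_toReal hC2.ne).1 hu.le
    have hl' : c.toReal ≤ f t * Real.exp (-(a * t)) :=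
      ((ENNReal.lt_ofReal_iff_toReal_lt hct).1 hl).le
    have he : Real.exp (-(a * (2 * t))) = Real.exp (-(a * t)) ^ 2 := by
      rw [← Real.exp_nat_mul]; congr 1; push_cast; ring
    have hq : f (2 * t) / f t ^ 2 =
        (f (2 * t) * Real.exp (-(a * (2 * t)))) / (f t * Real.exp (-(a * t))) ^ 2 := by
      rw [he, mul_pow, mul_div_mul_right _ _ (by positivity)]
    rw [hq]
    have := hpos (2 * t) (by linarith)
    gcongr
  · intro hq
    obtain ⟨C, hC1, hC2⟩ := exists_between hq
    have h1 := eventually_lt_of_limsup_lt hC1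
    obtain ⟨K, hK, hCK⟩ : ∃ K : ℝ, 0 < K ∧ C.toReal ≤ K :=
      ⟨C.toReal + 1, by positivity, by linarith⟩
    obtain ⟨T, hT⟩ := eventually_atTop.1 h1
    have step : ∀ t : ℝ, 0 < t → T ≤ t →
        Real.log (f (2 * t)) ≤ Real.log K + 2 * Real.log (f t) := by
      intro t ht hTt
      have hu := ((ENNReal.ofReal_le_iff_le_toReal hC2.ne).1 (hT t hTt).le).trans hCK
      have hft := hf t ht
      rw [div_le_iff₀ (by positivity)] at hu
      have := Real.log_le_log (hf (2 * t) (by linarith)) hu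
      rw [Real.log_mul hK.ne' (by positivity), Real.log_pow] at this
      exact_mod_cast this
    have iter : ∀ t : ℝ, 0 < t → T ≤ t → ∀ n : ℕ,
        Real.log (f (2 ^ n * t)) + Real.log K ≤ 2 ^ n * (Real.log (f t) + Real.log K) := by
      intro t ht hTt n
      induction n with
      | zero => simp
      | succ n ih =>
        have hge : t ≤ 2 ^ n * t :=
          le_mul_of_one_le_left ht.le (one_le_pow₀ (by norm_num))
        have := step (2 ^ n * t) (by positivity) (hTt.trans hge)
        rw [← mul_assoc, ← pow_succ'] at this
        rw [pow_succ'] at this ⊢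
        linarith
    have key : ∀ t : ℝ, 0 < t → T ≤ t → a ≤ (Real.log (f t) + Real.log K) / t := by
      intro t ht hTt
      have hu : Tendsto (fun n : ℕ => (2 : ℝ) ^ n * t) atTop atTop :=
        (tendsto_pow_atTop_atTop_of_one_lt (by norm_num)).atTop_mul_const ht
      have hl := (ha.comp hu).add (tendsto_const_nhds (x := Real.log K) |>.div_atTop hu)
      rw [add_zero] at hl
      refine le_of_tendsto hl (Eventually.of_forall fun n => ?_)
      have h2 : (0 : ℝ) < 2 ^ n := by positivity
      simp only [Function.comp]
      rw [← add_div, div_le_div_iff₀ (by positivity) ht]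
      nlinarith [mul_le_mul_of_nonneg_right (iter t ht hTt n) ht.le]
    refine lt_of_lt_of_le (ENNReal.ofReal_pos.2 (inv_pos.2 hK))
      (le_liminf_of_le (by isBoundedDefault) ?_)
    filter_upwards [eventually_gt_atTop 0, eventually_ge_atTop T] with t ht hTt
    apply ENNReal.ofReal_le_ofReal
    have h := key t ht hTt
    rw [le_div_iff₀ ht] at h
    rw [← Real.log_le_log_iff (inv_pos.2 hK) (hpos t ht), Real.log_inv,
      Real.log_mul (hf t ht).ne' (Real.exp_pos _).ne', Real.log_exp]
    linarith
end

section
/- Let X be an n-dimensional centered Gaussian random vector. (1) If f_1, …, f_k: ℝ^n → [0,∞] are symmetric (with respect to the point reflection x ↦ −x) and quasiconcave, and f_{k+1}: ℝ^n → [0,∞] is symmetric and quasiconvex, then E[∏_{i=1}^{k+1} f_i(X)] ≤ E[∏_{i=1}^{k} f_i(X)] · E[f_{k+1}(X)]. (2) If f_1, …, f_m: ℝ^n → [0,∞] are symmetric and quasiconcave, then for any partition {1,…,m} = J_1 ∪ ⋯ ∪ J_k into pairwise disjoint sets, E[∏_{i=1}^m f_i(X)] ≥ ∏_{i=1}^{k}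 E[∏_{j∈J_i} f_j(X)]. -/
/- Statement 17 (Proposition `Gaussian correlation inequality`): Let `X` be an
`n`-dimensional centered Gaussian vector.
(1) If `f_1, …, f_k : ℝⁿ → [0,∞]` are symmetric and quasiconcave and `f_{k+1}` is symmetric
and quasiconvex, then `E[∏_{i=1}^{k+1} f_i(X)] ≤ E[∏_{i=1}^{k} f_i(X)] · E[f_{k+1}(X)]`.
(2) If `f_1, …, f_m` are symmetric and quasiconcave, then for any partition
`{1,…,m} = J_1 ∪ ⋯ ∪ J_k` into pairwise disjoint sets,
`E[∏_{i=1}^m f_i(X)] ≥ ∏_{i=1}^{k} E[∏_{j ∈ J_i} f_j(X)]`. -/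

open MeasureTheory ProbabilityTheory Filter Set
open scoped ENNReal NNReal Topology

noncomputable section

namespace GaussianCorrelation

/-- `μ` is a centered Gaussian measure on `ℝⁿ`: a probability measure all of whose
one-dimensional linear projections are centered Gaussian. -/
def IsCenteredGaussian {n : ℕ} (μ : Measure (Fin n → ℝ)) : Prop :=
  IsProbabilityMeasure μ ∧
    ∀ L : (Fin n → ℝ) →ₗ[ℝ] ℝ, ∃ v : ℝ≥0, μ.map L = gaussianReal 0 v

/-- `f` is symmetric with respect to the point reflection at the origin. -/
def SymmetricFn {n : ℕ} (f : (Fin n → ℝ) → ℝ≥0∞) : Prop := ∀ x, f (-x) = f x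

/-- `f : ℝⁿ → [0,∞]` is quasiconcave: all superlevel sets are convex. -/
def QuasiConcaveFn {n : ℕ} (f : (Fin n → ℝ) → ℝ≥0∞) : Prop :=
  ∀ c : ℝ≥0∞, Convex ℝ {x | c ≤ f x}

/-- `f : ℝⁿ → [0,∞]` is quasiconvex: all sublevel sets are convex. -/
def QuasiConvexFn {n : ℕ} (f : (Fin n → ℝ) → ℝ≥0∞) : Prop :=
  ∀ c : ℝ≥0∞, Convex ℝ {x | f x ≤ c}

section MatrixPart
open Matrix

lemma det_one_add_psd_ge {n : Type*} [Fintype n] [DecidableEq n] {Q : Matrix n n ℝ}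
    (hQ : Q.PosSemidef) : 1 ≤ (1 + Q).det := by
  have h := hQ.1
  have e : (1 + Q).det = ∏ i, (1 + h.eigenvalues i) := by
    have h1 := h.charpoly_eq
    have h2 := Matrix.eval_charpoly Q (-1)
    rw [h1] at h2
    have h3 : (Matrix.scalar n (-1 : ℝ) - Q) = - (1 + Q) := by
      simp [Matrix.scalar_apply, ← Matrix.diagonal_neg]; abel
    rw [h3, Matrix.det_neg, Polynomial.eval_prod] at h2
    simp only [Polynomial.eval_sub, Polynomial.eval_X, Polynomial.eval_C] at h2
    have h4 : ∏ i, (-1 - (h.eigenvalues i)) = (-1) ^ Fintype.card n * ∏ i, (1 + h.eigenvalues i) := by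
      rw [← Finset.card_univ, ← Finset.prod_const, ← Finset.prod_mul_distrib]
      exact Finset.prod_congr rfl (fun i _ => by ring)
    have h5 : ∏ i, (-1 - (h.eigenvalues i)) = (-1) ^ Fintype.card n * (1 + Q).det := by
      simpa using h2
    rw [h4] at h5
    exact (mul_left_cancel₀ (by simp) h5).symm
  rw [e]
  exact Finset.one_le_prod (fun i _ => by
    have := hQ.eigenvalues_nonneg i
    linarith)

open scoped MatrixOrder in
lemma psd_factor {n : Type*} [Fintype n] [DecidableEq n] {M : Matrix n n ℝ}
    (hM : M.PosSemidef) : ∃ R : Matrix n n ℝ, M = Rᴴ * R := by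
  obtain ⟨B, hB⟩ := CStarAlgebra.nonneg_iff_eq_star_mul_self.mp hM.nonneg
  exact ⟨B, hB⟩

lemma det_mono {n : Type*} [Fintype n] [DecidableEq n] {M P : Matrix n n ℝ}
    (hM : M.PosSemidef) (hP : P.PosSemidef) : M.det ≤ (M + P).det := by
  by_cases h0 : M.det = 0
  · rw [h0]; exact (hM.add hP).det_nonneg
  obtain ⟨R, hR⟩ := psd_factor hM
  have hRd : R.det ≠ 0 := by
    intro h; apply h0; rw [hR, det_mul, h, mul_zero]
  have hu : IsUnit R.det := isUnit_iff_ne_zero.mpr hRd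
  have hu' : IsUnit (Rᴴ).det := by
    rw [Matrix.det_conjTranspose]; simpa using hRd
  have key : M + P = Rᴴ * (1 + (R⁻¹)ᴴ * P * R⁻¹) * R := by
    have e1 : Rᴴ * (R⁻¹)ᴴ = 1 := by
      rw [← conjTranspose_mul, Matrix.nonsing_inv_mul _ hu]; simp
    have e2 : R⁻¹ * R = 1 := Matrix.nonsing_inv_mul _ hu
    rw [hR]
    calc Rᴴ * R + P = Rᴴ * R + (Rᴴ * (R⁻¹)ᴴ) * P * (R⁻¹ * R) := by rw [e1, e2]; simp
      _ = _ := by noncomm_ring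
  have hps : ((R⁻¹)ᴴ * P * R⁻¹).PosSemidef := hP.conjTranspose_mul_mul_same _
  have h1 := det_one_add_psd_ge hps
  rw [key, det_mul, det_mul, hR, det_mul, det_conjTranspose]
  simp only [star_trivial]
  nlinarith [mul_self_nonneg R.det]

variable {m n : Type*} [Fintype m] [Fintype n] [DecidableEq m] [DecidableEq n]

/-- scale the off-diagonal blocks by `t`. -/
def interp (C : Matrix (m ⊕ n) (m ⊕ n) ℝ) (t : ℝ) : Matrix (m ⊕ n) (m ⊕ n) ℝ :=
  fromBlocks C.toBlocks₁₁ (t • C.toBlocks₁₂) (t • C.toBlocks₂₁) C.toBlocks₂₂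

lemma interp_one (C : Matrix (m ⊕ n) (m ⊕ n) ℝ) : interp C 1 = C := by
  simp [interp, fromBlocks_toBlocks]

lemma interp_psd {C : Matrix (m ⊕ n) (m ⊕ n) ℝ} (hC : C.PosSemidef) {t : ℝ}
    (h0 : 0 ≤ t) (h1 : t ≤ 1) : (interp C t).PosSemidef := by
  let K : Matrix (m ⊕ n) (m ⊕ n) ℝ := fromBlocks 1 0 0 (-1)
  have hK : (Kᴴ * C * K).PosSemidef := hC.conjTranspose_mul_mul_same K
  have e : interp C t = ((1 + t) / 2) • C + ((1 - t) / 2) • (Kᴴ * C * K) := by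
    conv_rhs => rw [← fromBlocks_toBlocks C]
    simp only [K, fromBlocks_conjTranspose, fromBlocks_multiply, fromBlocks_smul, fromBlocks_add,
      interp]
    congr 1 <;> ext i j <;> simp <;> ring
  rw [e]
  exact (hC.smul (by linarith)).add (hK.smul (by linarith))

lemma interp_det_anti {C : Matrix (m ⊕ n) (m ⊕ n) ℝ} (hC : C.PosSemidef) {s t : ℝ}
    (h0 : 0 ≤ s) (hst : s ≤ t) (h1 : t ≤ 1) : (interp C t).det ≤ (interp C s).det := by
  have ht := interp_psd hC (h0.trans hst) h1
  have hs := interp_psd hC h0 (hst.trans h1)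
  by_cases hd : (interp C t).det = 0
  · rw [hd]; exact hs.det_nonneg
  have htp : (interp C t).PosDef := ht.posDef_iff_det_ne_zero.mpr hd
  set A := C.toBlocks₁₁ with hAd
  set B := C.toBlocks₁₂ with hBd
  set D := C.toBlocks₂₂ with hDd
  have hB' : C.toBlocks₂₁ = Bᴴ := by
    ext i j
    have := hC.1.apply (Sum.inr i) (Sum.inl j)
    simp [B, toBlocks₂₁, toBlocks₁₂] at this ⊢
    exact this.symm
  have hA : A.PosDef := by
    have := htp.submatrix (e := (Sum.inl : m → m ⊕ n)) Sum.inl_injective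
    have e : (interp C t).submatrix (Sum.inl : m → m ⊕ n) Sum.inl = A := by
      ext i j; simp [interp, A]
    rwa [e] at this
  have hdA : IsUnit A.det := isUnit_iff_ne_zero.mpr hA.det_pos.ne'
  let _ : Invertible A := A.invertibleOfIsUnitDet hdA
  have hE : (Bᴴ * A⁻¹ * B).PosSemidef := hA.inv.posSemidef.conjTranspose_mul_mul_same B
  have hform : ∀ r : ℝ, interp C r = fromBlocks A (r • B) (r • B)ᴴ D := by
    intro r; simp [interp, hB', A, B, D]
  have hS : ((D - (t • B)ᴴ * A⁻¹ * (t • B))).PosSemidef := by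
    rw [← Matrix.PosDef.fromBlocks₁₁ _ _ hA, ← hform]; exact ht
  have hdet : ∀ r : ℝ, (interp C r).det = A.det * (D - (r • B)ᴴ * A⁻¹ * (r • B)).det := by
    intro r
    rw [hform, det_fromBlocks₁₁, invOf_eq_nonsing_inv]
  rw [hdet, hdet]
  refine mul_le_mul_of_nonneg_left ?_ hA.det_pos.le
  have e : D - (s • B)ᴴ * A⁻¹ * (s • B) =
      (D - (t • B)ᴴ * A⁻¹ * (t • B)) + (t ^ 2 - s ^ 2) • (Bᴴ * A⁻¹ * B) := by
    simp only [conjTranspose_smul, star_trivial, Matrix.smul_mul, Matrix.mul_smul, smul_smul, sub_smul]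
    rw [pow_two, pow_two]; abel
  rw [e]
  exact det_mono hS (hE.smul (by nlinarith))

/-- the coordinate projection matrix -/
def projM {ι : Type*} [DecidableEq ι] (J : Finset ι) : Matrix ι ι ℝ :=
  diagonal (fun i => if i ∈ J then 1 else 0)

lemma projM_mul_self {ι : Type*} [Fintype ι] [DecidableEq ι] (J : Finset ι) :
    projM J * projM J = projM J := by
  simp [projM]

/-- compression of `C` to `J`, filled up with the identity -/
def compr {ι : Type*} [Fintype ι] [DecidableEq ι] (J : Finset ι) (C : Matrix ι ι ℝ) :
    Matrix ι ι ℝ := 1 - projM J + projM J * C * projM J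

lemma compr_psd {ι : Type*} [Fintype ι] [DecidableEq ι] (J : Finset ι) {C : Matrix ι ι ℝ}
    (hC : C.PosSemidef) : (compr J C).PosSemidef := by
  have hT : (projM J)ᴴ = projM J := by
    simp [projM, diagonal_conjTranspose]
  refine PosSemidef.add ?_ ?_
  · have : (1 - projM J : Matrix ι ι ℝ) = diagonal (fun i => if i ∈ J then 0 else 1) := by
      rw [projM, ← diagonal_one, diagonal_sub]; congr 1; ext i; split_ifs <;> simp
    rw [this]
    exact PosSemidef.diagonal (fun i => by simp only [Pi.zero_apply]; split_ifs <;> norm_num)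
  · have := hC.conjTranspose_mul_mul_same (projM J)
    rwa [hT] at this

lemma compr_interp (J : Finset (m ⊕ n)) (C : Matrix (m ⊕ n) (m ⊕ n) ℝ) (t : ℝ) :
    compr J (interp C t) = interp (compr J C) t := by
  ext i j
  rcases i with i | i <;> rcases j with j | j <;>
    simp [compr, projM, interp, toBlocks₁₁, toBlocks₁₂, toBlocks₂₁, toBlocks₂₂,
      Matrix.one_apply, Matrix.diagonal_apply]

lemma det_expand {ι : Type*} [Fintype ι] [DecidableEq ι] (l : ι → ℝ) (C : Matrix ι ι ℝ) :
    (1 + diagonal l * C).det = ∑ J : Finset ι, (∏ i ∈ J, l i) * (compr J C).det := by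
  have e : (1 + diagonal l * C) = (Matrix.of (fun i => l i • C i)) + (1 : Matrix ι ι ℝ) := by
    ext i j; simp [add_comm]
  have h := (detRowAlternating (R := ℝ) (n := ι)).map_add_univ (fun i => l i • C i)
    (1 : Matrix ι ι ℝ)
  rw [e]
  refine h.trans (Finset.sum_congr rfl fun J _ => ?_)
  have pm : ∀ (f g : ι → ι → ℝ) i, i ∈ J → J.piecewise f g i = f i :=
    fun f g i h => Finset.piecewise_eq_of_mem _ _ _ h
  have pn : ∀ (f g : ι → ι → ℝ) i, i ∉ J → J.piecewise f g i = g i :=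
    fun f g i h => Finset.piecewise_eq_of_notMem _ _ _ h
  have hq : J.piecewise (fun i => l i • C i) (1 : Matrix ι ι ℝ) =
      J.piecewise (fun i => l i • (J.piecewise C (1 : Matrix ι ι ℝ)) i)
        (J.piecewise C (1 : Matrix ι ι ℝ)) := by
    funext i
    by_cases hi : i ∈ J
    · refine (pm _ _ i hi).trans ((pm _ _ i hi).trans ?_).symm
      exact congrArg (fun r => l i • r) (pm _ _ i hi)
    · exact (pn _ _ i hi).trans ((pn _ _ i hi).trans (pn _ _ i hi)).symm
  rw [hq]
  have h2 := (detRowAlternating (R := ℝ) (n := ι)).toMultilinearMap.map_piecewise_smul l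
    (J.piecewise C (1 : Matrix ι ι ℝ)) J
  refine h2.trans ?_
  rw [smul_eq_mul]
  congr 1
  change det (Matrix.of (J.piecewise C (1 : Matrix ι ι ℝ))) = _
  have e1 : Matrix.of (J.piecewise C (1 : Matrix ι ι ℝ)) = 1 - projM J + projM J * C := by
    ext i j
    rw [Matrix.of_apply]
    by_cases hi : i ∈ J
    · refine (congrFun (pm _ _ i hi) j).trans ?_
      simp [hi, projM, Matrix.diagonal_apply, Matrix.one_apply]
    · refine (congrFun (pn _ _ i hi) j).trans ?_
      simp [hi, projM, Matrix.diagonal_apply, Matrix.one_apply]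
  have e2 : 1 - projM J + projM J * C =
      (1 + projM J * (C * (1 - projM J))) * compr J C := by
    have hP := projM_mul_self J
    have hP2 : (1 - projM J) * projM J = 0 := by rw [sub_mul, hP]; simp
    have hP3 : (1 - projM J) * (1 - projM J) = 1 - projM J := by
      rw [mul_sub, hP2]; simp
    unfold compr
    calc 1 - projM J + projM J * C = 1 - projM J + projM J * C * projM J
          + projM J * C * (1 - projM J) + projM J * C * 0 * (C * projM J) := by noncomm_ring
      _ = 1 - projM J + projM J * C * projM J
          + projM J * C * ((1 - projM J) * (1 - projM J))
          + projM J * C * ((1 - projM J) * projM J) * (C * projM J) := by rw [hP3, hP2]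
      _ = _ := by simp only [Matrix.mul_add, Matrix.add_mul, Matrix.mul_assoc, Matrix.one_mul]; abel
  have e3 : (1 + projM J * (C * (1 - projM J))).det = 1 := by
    rw [det_one_add_mul_comm]
    have hP2 : (1 - projM J) * projM J = 0 := by rw [sub_mul, projM_mul_self J]; simp
    rw [Matrix.mul_assoc, hP2]; simp
  rw [e1, e2, det_mul, e3, one_mul]

end MatrixPart

section GaussPart
open Matrix

/-- the standard Gaussian measure on `κ → ℝ` -/
abbrev stdG (κ : Type*) [Fintype κ] : Measure (κ → ℝ) := Measure.pi (fun _ => gaussianReal 0 1)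

/-- the standard Gaussian density -/
def dens (κ : Type*) [Fintype κ] (x : κ → ℝ) : ℝ := ∏ i, gaussianPDFReal 0 1 (x i)

lemma dens_nonneg {κ : Type*} [Fintype κ] (x : κ → ℝ) : 0 ≤ dens κ x :=
  Finset.prod_nonneg fun i _ => gaussianPDFReal_nonneg _ _ _

lemma dens_measurable (κ : Type*) [Fintype κ] : Measurable (dens κ) := by
  unfold dens
  exact Finset.measurable_prod _ fun i _ =>
    (measurable_gaussianPDFReal 0 1).comp (measurable_pi_apply i)

lemma stdG_eq (κ : Type*) [Fintype κ] :
    stdG κ = volume.withDensity (fun x => ENNReal.ofReal (dens κ x)) := by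
  refine Measure.pi_eq fun s hs => ?_
  have hint : ∀ i, Integrable (gaussianPDFReal 0 1) (volume.restrict (s i)) := fun i =>
    (integrable_gaussianPDFReal 0 1).restrict
  rw [withDensity_apply _ (MeasurableSet.univ_pi hs), volume_pi, Measure.restrict_pi_pi]
  rw [← ofReal_integral_eq_lintegral_ofReal]
  · unfold dens
    rw [integral_fintype_prod_eq_prod (μ := fun i => volume.restrict (s i)) (fun _ => gaussianPDFReal 0 1),
      ENNReal.ofReal_prod_of_nonneg]
    · refine Finset.prod_congr rfl fun i _ => ?_
      rw [gaussianReal_apply_eq_integral _ (by norm_num)]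
    · intro i _
      exact integral_nonneg fun x => gaussianPDFReal_nonneg _ _ _
  · exact Integrable.fintype_prod (μ := fun i => volume.restrict (s i)) (f := fun _ => gaussianPDFReal 0 1) hint
  · exact ae_of_all _ fun x => dens_nonneg x

lemma stdG_ac (κ : Type*) [Fintype κ] : stdG κ ≪ volume := by
  rw [stdG_eq]; exact withDensity_absolutelyContinuous _ _

lemma integral_dens (κ : Type*) [Fintype κ] : ∫ x, dens κ x = 1 := by
  unfold dens
  rw [integral_fintype_prod_volume_eq_prod (fun (_ : κ) => gaussianPDFReal 0 1)]
  simp [integral_gaussianPDFReal_eq_one]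

lemma integral_stdG {κ : Type*} [Fintype κ] (f : (κ → ℝ) → ℝ) :
    ∫ x, f x ∂(stdG κ) = ∫ x, dens κ x * f x := by
  rw [stdG_eq, integral_withDensity_eq_integral_toReal_smul]
  · simp [ENNReal.toReal_ofReal, dens_nonneg]
  · exact (dens_measurable κ).ennreal_ofReal
  · exact ae_of_all _ fun x => ENNReal.ofReal_lt_top

lemma gauss_integral {ι κ : Type*} [Fintype ι] [Fintype κ] [DecidableEq ι] [DecidableEq κ]
    (S : Matrix ι κ ℝ) (l : ι → ℝ) (hl : ∀ i, 0 ≤ l i) :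
    0 < (1 + diagonal l * (S * Sᵀ)).det ∧
    ∫ x, Real.exp (-(∑ i, l i * (S *ᵥ x) i ^ 2) / 2) ∂(stdG κ) =
      (√((1 + diagonal l * (S * Sᵀ)).det))⁻¹ := by
  have hQ : (Sᵀ * diagonal l * S).PosSemidef := by
    have := (PosSemidef.diagonal (n := ι) (d := l) hl).conjTranspose_mul_mul_same S
    simpa using this
  have hdet : (1 + diagonal l * (S * Sᵀ)).det = (1 + Sᵀ * diagonal l * S).det := by
    rw [← Matrix.mul_assoc, det_one_add_mul_comm, Matrix.mul_assoc]
  have hge := det_one_add_psd_ge hQ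
  obtain ⟨R, hR⟩ := psd_factor (PosSemidef.one.add hQ)
  have hdR : (1 + Sᵀ * diagonal l * S).det = R.det ^ 2 := by
    rw [hR, det_mul, det_conjTranspose]; simp [pow_two]
  rw [hdet]
  refine ⟨by linarith, ?_⟩
  have hR0 : R.det ≠ 0 := by
    intro h; rw [h] at hdR; norm_num at hdR; linarith
  rw [hdR, Real.sqrt_sq_eq_abs, integral_stdG]
  have hquad : ∀ x : κ → ℝ, ∑ j, (R *ᵥ x) j ^ 2 = ∑ j, x j ^ 2 + ∑ i, l i * (S *ᵥ x) i ^ 2 := by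
    intro x
    have e1 : ∑ j, (R *ᵥ x) j ^ 2 = (R *ᵥ x) ⬝ᵥ (R *ᵥ x) := by
      simp [dotProduct, pow_two]
    have e2 : (R *ᵥ x) ⬝ᵥ (R *ᵥ x) = x ⬝ᵥ ((Rᴴ * R) *ᵥ x) := by
      rw [← mulVec_mulVec, conjTranspose_eq_transpose_of_trivial, dotProduct_mulVec x,
        vecMul_transpose]
    rw [e1, e2, ← hR, add_mulVec, dotProduct_add, one_mulVec, Matrix.mul_assoc, ← mulVec_mulVec,
      dotProduct_mulVec x, vecMul_transpose, ← mulVec_mulVec]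
    congr 1
    · simp [dotProduct, pow_two]
    · simp only [dotProduct, mulVec_diagonal]
      exact Finset.sum_congr rfl fun i _ => by ring
  have hdens : ∀ x : κ → ℝ, dens κ x =
      (√(2 * Real.pi))⁻¹ ^ Fintype.card κ * Real.exp (-(∑ j, x j ^ 2) / 2) := by
    intro x
    unfold dens gaussianPDFReal
    rw [Finset.prod_mul_distrib, ← Real.exp_sum]
    simp [Finset.sum_div, Finset.sum_neg_distrib, neg_div]
  have hpt : ∀ x : κ → ℝ, dens κ x * Real.exp (-(∑ i, l i * (S *ᵥ x) i ^ 2) / 2) =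
      dens κ (toLin' R x) := by
    intro x
    rw [hdens, hdens, mul_assoc, ← Real.exp_add, toLin'_apply, hquad]
    congr 2; ring
  simp_rw [hpt]
  have hmeas : Measurable (toLin' R) := (LinearMap.continuous_on_pi _).measurable
  rw [← integral_map (φ := toLin' R) (f := dens κ) hmeas.aemeasurable
    (dens_measurable κ).aestronglyMeasurable, Real.map_matrix_volume_pi_eq_smul_volume_pi hR0,
    integral_smul_measure, integral_dens]
  simp [abs_inv]

end GaussPart

section RoyenPart
open Matrix

lemma laplace_expand {Ω ι : Type*} [MeasurableSpace Ω] [Fintype ι] [DecidableEq ι]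
    (ν : Measure Ω) [IsProbabilityMeasure ν] (Y : Ω → ι → ℝ) (hY : ∀ i, Measurable fun w => Y w i)
    (hY0 : ∀ w i, 0 ≤ Y w i) (d : ℕ) (c : ι → ℕ → ℝ) :
    ∫ w, ∏ i, ∑ k ∈ Finset.range d, c i k * Real.exp (-Y w i) ^ k ∂ν =
      ∑ a ∈ Fintype.piFinset (fun _ : ι => Finset.range d),
        (∏ i, c i (a i)) * ∫ w, Real.exp (-∑ i, (a i : ℝ) * Y w i) ∂ν := by
  have hpt : ∀ w, ∏ i, ∑ k ∈ Finset.range d, c i k * Real.exp (-Y w i) ^ k =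
      ∑ a ∈ Fintype.piFinset (fun _ : ι => Finset.range d),
        (∏ i, c i (a i)) * Real.exp (-∑ i, (a i : ℝ) * Y w i) := by
    intro w
    rw [Finset.prod_univ_sum]
    refine Finset.sum_congr rfl fun a _ => ?_
    rw [Finset.prod_mul_distrib, ← Finset.sum_neg_distrib, Real.exp_sum]
    congr 1
    refine Finset.prod_congr rfl fun i _ => ?_
    rw [← Real.exp_nat_mul]; congr 1; ring
  simp_rw [hpt]
  rw [integral_finsetSum]
  · simp_rw [integral_const_mul]
  · intro a _
    refine Integrable.const_mul ?_ _
    refine Integrable.of_bound (C := 1) ?_ (ae_of_all _ fun w => ?_)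
    · refine Measurable.aestronglyMeasurable ?_
      refine Real.measurable_exp.comp (Measurable.neg ?_)
      exact Finset.measurable_sum _ fun i _ => (hY i).const_mul _
    · rw [Real.norm_eq_abs, abs_of_pos (Real.exp_pos _)]
      rw [Real.exp_le_one_iff, neg_nonpos]
      exact Finset.sum_nonneg fun i _ => mul_nonneg (Nat.cast_nonneg _) (hY0 w i)

lemma mulVec_meas {ι κ : Type*} [Fintype κ] (S : Matrix ι κ ℝ) (i : ι) :
    Measurable fun x : κ → ℝ => (S *ᵥ x) i := by
  unfold mulVec dotProduct
  exact Finset.measurable_sum _ fun j _ => (measurable_pi_apply j).const_mul _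

/-- one copy -/
lemma laplace_one {ι κ : Type*} [Fintype ι] [Fintype κ] [DecidableEq ι] [DecidableEq κ]
    (S : Matrix ι κ ℝ) (d : ℕ) (c : ι → ℕ → ℝ) :
    ∫ x, ∏ i, ∑ k ∈ Finset.range d, c i k * Real.exp (-((S *ᵥ x) i ^ 2 / 2)) ^ k ∂(stdG κ) =
      ∑ a ∈ Fintype.piFinset (fun _ : ι => Finset.range d),
        (∏ i, c i (a i)) * (√((1 + diagonal (fun i => (a i : ℝ)) * (S * Sᵀ)).det))⁻¹ := by
  rw [laplace_expand (stdG κ) (fun x i => (S *ᵥ x) i ^ 2 / 2)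
    (fun i => ((mulVec_meas S i).pow_const 2).div_const 2) (fun w i => by positivity)]
  refine Finset.sum_congr rfl fun a _ => ?_
  rw [← (gauss_integral S (fun i => (a i : ℝ)) (fun i => Nat.cast_nonneg _)).2]
  congr 2
  ext x
  rw [neg_div, Finset.sum_div]
  congr 2
  exact Finset.sum_congr rfl fun i _ => by ring

/-- three copies -/
lemma laplace_three {ι κ : Type*} [Fintype ι] [Fintype κ] [DecidableEq ι] [DecidableEq κ]
    (S : Matrix ι κ ℝ) (d : ℕ) (c : ι → ℕ → ℝ)
    (hc : ∀ i, ∀ y : ℝ, 0 ≤ y → y ≤ 1 → 0 ≤ ∑ k ∈ Finset.range d, c i k * y ^ k) :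
    0 ≤ ∑ a ∈ Fintype.piFinset (fun _ : ι => Finset.range d),
        (∏ i, c i (a i)) * (√((1 + diagonal (fun i => (a i : ℝ)) * (S * Sᵀ)).det))⁻¹ ^ 3 := by
  have h := laplace_expand (Measure.pi fun _ : Fin 3 => stdG κ)
    (fun x i => ∑ s, (S *ᵥ (x s)) i ^ 2 / 2)
    (fun i => Finset.measurable_sum _ fun s _ =>
      ((((mulVec_meas S i).comp (measurable_pi_apply s)).pow_const 2).div_const 2))
    (fun w i => Finset.sum_nonneg fun s _ => by positivity) d c
  have e : ∀ a ∈ Fintype.piFinset (fun _ : ι => Finset.range d),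
      (∏ i, c i (a i)) * (√((1 + diagonal (fun i => (a i : ℝ)) * (S * Sᵀ)).det))⁻¹ ^ 3 =
      (∏ i, c i (a i)) * ∫ x, Real.exp (-∑ i, (a i : ℝ) * ∑ s, (S *ᵥ (x s)) i ^ 2 / 2)
        ∂(Measure.pi fun _ : Fin 3 => stdG κ) := by
    intro a _
    congr 1
    rw [← (gauss_integral S (fun i => (a i : ℝ)) (fun i => Nat.cast_nonneg _)).2]
    have := integral_fintype_prod_eq_pow (ι := Fin 3) (μ := stdG κ)
      (fun x : κ → ℝ => Real.exp (-(∑ i, (a i : ℝ) * (S *ᵥ x) i ^ 2) / 2))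
    rw [Fintype.card_fin] at this
    rw [← this]
    congr 1
    ext x
    rw [← Real.exp_sum]
    congr 1
    simp_rw [neg_div, Finset.sum_neg_distrib, Finset.mul_sum, Finset.sum_div]
    rw [Finset.sum_comm]
    congr 1
    refine Finset.sum_congr rfl fun i _ => Finset.sum_congr rfl fun s _ => by ring
  rw [Finset.sum_congr rfl e, ← h]
  refine integral_nonneg fun x => Finset.prod_nonneg fun i _ => hc i _ (Real.exp_pos _).le ?_
  rw [Real.exp_le_one_iff, neg_nonpos]
  exact Finset.sum_nonneg fun s _ => by positivity

variable {m n : Type*} [Fintype m] [Fintype n] [DecidableEq m] [DecidableEq n]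

lemma interp_differentiable (C : Matrix (m ⊕ n) (m ⊕ n) ℝ) :
    Differentiable ℝ (fun t => (interp C t).det) := by
  have he : ∀ i j, Differentiable ℝ (fun t => interp C t i j) := by
    intro i j
    rcases i with i | i <;> rcases j with j | j <;> simp [interp]
  simp_rw [Matrix.det_apply]
  refine Differentiable.fun_sum fun σ _ => Differentiable.fun_const_smul ?_ _
  exact Differentiable.fun_finsetProd fun i _ => he _ _

lemma interp_deriv_nonpos {C : Matrix (m ⊕ n) (m ⊕ n) ℝ} (hC : C.PosSemidef) {t : ℝ}
    (ht : t ∈ Ioo (0 : ℝ) 1) : deriv (fun t => (interp C t).det) t ≤ 0 := by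
  have hanti : AntitoneOn (fun t => (interp C t).det) (Icc 0 1) := fun s hs t ht hst =>
    interp_det_anti hC hs.1 hst ht.2
  have h1 : derivWithin (fun t => (interp C t).det) (Icc 0 1) t ≤ 0 := hanti.derivWithin_nonpos
  rwa [derivWithin_of_mem_nhds (Icc_mem_nhds ht.1 ht.2)] at h1

lemma royen_mono {C : Matrix (m ⊕ n) (m ⊕ n) ℝ} (hC : C.PosSemidef) (d : ℕ) (c : ℕ → ℝ)
    (h0 : ∀ y : ℝ, 0 ≤ y → y ≤ 1 → 0 ≤ ∑ k ∈ Finset.range d, c k * y ^ k)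
    (h1 : ∀ y : ℝ, 0 ≤ y → y ≤ 1 → 0 ≤ ∑ k ∈ Finset.range d, c k * k * y ^ k) :
    ∑ a ∈ Fintype.piFinset (fun _ : m ⊕ n => Finset.range d), (∏ i, c (a i)) *
      (√((1 + diagonal (fun i => (a i : ℝ)) * interp C 0).det))⁻¹ ≤
    ∑ a ∈ Fintype.piFinset (fun _ : m ⊕ n => Finset.range d), (∏ i, c (a i)) *
      (√((1 + diagonal (fun i => (a i : ℝ)) * interp C 1).det))⁻¹ := by
  set w : Finset (m ⊕ n) → ℝ → ℝ := fun J t => (interp (compr J C) t).det with hw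
  have hD : ∀ (a : m ⊕ n → ℕ) (t : ℝ), (1 + diagonal (fun i => (a i : ℝ)) * interp C t).det =
      ∑ J : Finset (m ⊕ n), (∏ i ∈ J, (a i : ℝ)) * w J t := by
    intro a t
    rw [det_expand]
    refine Finset.sum_congr rfl fun J _ => ?_
    rw [compr_interp]
  have hpos : ∀ (a : m ⊕ n → ℕ) (t : ℝ), t ∈ Icc (0 : ℝ) 1 →
      0 < (1 + diagonal (fun i => (a i : ℝ)) * interp C t).det := by
    intro a t ht
    obtain ⟨R, hR⟩ := psd_factor (interp_psd hC ht.1 ht.2)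
    have := (gauss_integral Rᵀ (fun i => (a i : ℝ)) (fun i => Nat.cast_nonneg _)).1
    rw [hR]; simpa using this
  have hdw : ∀ J, Differentiable ℝ (w J) := fun J => interp_differentiable _
  set G : ℝ → ℝ := fun t => ∑ a ∈ Fintype.piFinset (fun _ : m ⊕ n => Finset.range d),
    (∏ i, c (a i)) * (√((1 + diagonal (fun i => (a i : ℝ)) * interp C t).det))⁻¹ with hG
  have hdD : ∀ (a : m ⊕ n → ℕ) (t : ℝ),
      HasDerivAt (fun t => (1 + diagonal (fun i => (a i : ℝ)) * interp C t).det)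
        (∑ J : Finset (m ⊕ n), (∏ i ∈ J, (a i : ℝ)) * deriv (w J) t) t := by
    intro a t
    simp_rw [hD]
    exact HasDerivAt.fun_sum fun J _ => ((hdw J t).hasDerivAt).const_mul _
  have hdG : ∀ t ∈ Icc (0 : ℝ) 1, HasDerivAt G (∑ a ∈ Fintype.piFinset
      (fun _ : m ⊕ n => Finset.range d), (∏ i, c (a i)) *
        (-(1 / 2) * (√((1 + diagonal (fun i => (a i : ℝ)) * interp C t).det))⁻¹ ^ 3 *
          ∑ J : Finset (m ⊕ n), (∏ i ∈ J, (a i : ℝ)) * deriv (w J) t)) t := by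
    intro t ht
    refine HasDerivAt.fun_sum fun a _ => HasDerivAt.const_mul _ ?_
    have hp := hpos a t ht
    have hs := ((hdD a t).sqrt hp.ne').inv (Real.sqrt_pos.mpr hp).ne'
    refine hs.congr_deriv ?_
    have := (Real.sqrt_pos.mpr hp).ne'
    field_simp
  have hmono : MonotoneOn G (Icc 0 1) := by
    refine monotoneOn_of_deriv_nonneg (convex_Icc 0 1) ?_ ?_ ?_
    · exact fun t ht => (hdG t ht).continuousAt.continuousWithinAt
    · rw [interior_Icc]
      exact fun t ht => (hdG t ⟨ht.1.le, ht.2.le⟩).differentiableAt.differentiableWithinAt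
    · rw [interior_Icc]
      intro t ht
      have ht' : t ∈ Icc (0 : ℝ) 1 := ⟨ht.1.le, ht.2.le⟩
      rw [(hdG t ht').deriv]
      obtain ⟨R, hR⟩ := psd_factor (interp_psd hC ht'.1 ht'.2)
      have hR' : interp C t = Rᵀ * Rᵀᵀ := by rw [hR]; simp
      have key : ∑ a ∈ Fintype.piFinset (fun _ : m ⊕ n => Finset.range d), (∏ i, c (a i)) *
          (-(1 / 2) * (√((1 + diagonal (fun i => (a i : ℝ)) * interp C t).det))⁻¹ ^ 3 *
          ∑ J : Finset (m ⊕ n), (∏ i ∈ J, (a i : ℝ)) * deriv (w J) t) =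
        ∑ J : Finset (m ⊕ n), (-(deriv (w J) t) / 2) *
          ∑ a ∈ Fintype.piFinset (fun _ : m ⊕ n => Finset.range d),
          (∏ i, (fun i k => c k * (if i ∈ J then (k : ℝ) else 1)) i (a i)) *
          (√((1 + diagonal (fun i => (a i : ℝ)) * interp C t).det))⁻¹ ^ 3 := by
        simp_rw [Finset.mul_sum]
        rw [Finset.sum_comm]
        refine Finset.sum_congr rfl fun J _ => Finset.sum_congr rfl fun a _ => ?_
        rw [Finset.prod_mul_distrib, Finset.prod_ite_mem, Finset.univ_inter]
        ring
      rw [key]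
      refine Finset.sum_nonneg fun J _ => mul_nonneg ?_ ?_
      · have := interp_deriv_nonpos (compr_psd J hC) ht
        have h' : deriv (w J) t ≤ 0 := this
        linarith
      · rw [hR']
        refine laplace_three Rᵀ d (fun i k => c k * (if i ∈ J then (k : ℝ) else 1)) ?_
        intro i y hy0 hy1
        by_cases hi : i ∈ J
        · simpa [hi] using h1 y hy0 hy1
        · simpa [hi] using h0 y hy0 hy1
  exact hmono (by simp) (by simp) zero_le_one

lemma royen_poly {κ : Type*} [Fintype κ] [DecidableEq κ] (S : Matrix m κ ℝ) (T : Matrix n κ ℝ)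
    (d : ℕ) (c : ℕ → ℝ)
    (h0 : ∀ y : ℝ, 0 ≤ y → y ≤ 1 → 0 ≤ ∑ k ∈ Finset.range d, c k * y ^ k)
    (h1 : ∀ y : ℝ, 0 ≤ y → y ≤ 1 → 0 ≤ ∑ k ∈ Finset.range d, c k * k * y ^ k) :
    (∫ x, ∏ i, ∑ k ∈ Finset.range d, c k * Real.exp (-((S *ᵥ x) i ^ 2 / 2)) ^ k ∂(stdG κ)) *
    (∫ x, ∏ i, ∑ k ∈ Finset.range d, c k * Real.exp (-((T *ᵥ x) i ^ 2 / 2)) ^ k ∂(stdG κ)) ≤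
    ∫ x, (∏ i, ∑ k ∈ Finset.range d, c k * Real.exp (-((S *ᵥ x) i ^ 2 / 2)) ^ k) *
      (∏ i, ∑ k ∈ Finset.range d, c k * Real.exp (-((T *ᵥ x) i ^ 2 / 2)) ^ k) ∂(stdG κ) := by
  set U : Matrix (m ⊕ n) κ ℝ := fromRows S T with hU
  have hblk : U * Uᵀ = fromBlocks (S * Sᵀ) (S * Tᵀ) (T * Sᵀ) (T * Tᵀ) := by
    rw [hU, transpose_fromRows, fromRows_mul_fromCols]
  have hpsd : (U * Uᵀ).PosSemidef := by
    have := posSemidef_self_mul_conjTranspose U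
    simpa using this
  have hm := royen_mono hpsd d c h0 h1
  rw [interp_one] at hm
  have hR := laplace_one U d (fun _ => c)
  rw [← hR] at hm
  have hL := laplace_expand ((stdG κ).prod (stdG κ))
    (fun x (i : m ⊕ n) => Sum.elim (fun i => (S *ᵥ x.1) i ^ 2 / 2) (fun i => (T *ᵥ x.2) i ^ 2 / 2) i)
    (by
      rintro (i | i)
      · exact (((mulVec_meas S i).comp measurable_fst).pow_const 2).div_const 2
      · exact (((mulVec_meas T i).comp measurable_snd).pow_const 2).div_const 2)
    (by rintro w (i | i) <;> simp <;> positivity) d (fun _ => c)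
  have e : ∀ a : m ⊕ n → ℕ, (√((1 + diagonal (fun i => (a i : ℝ)) * interp (U * Uᵀ) 0).det))⁻¹ =
      ∫ w, Real.exp (-∑ i, (a i : ℝ) * (Sum.elim (fun i => (S *ᵥ w.1) i ^ 2 / 2)
        (fun i => (T *ᵥ w.2) i ^ 2 / 2) i)) ∂((stdG κ).prod (stdG κ)) := by
    intro a
    have hS := gauss_integral S (fun i => (a (Sum.inl i) : ℝ)) (fun i => Nat.cast_nonneg _)
    have hT := gauss_integral T (fun i => (a (Sum.inr i) : ℝ)) (fun i => Nat.cast_nonneg _)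
    have hd : (1 + diagonal (fun i => (a i : ℝ)) * interp (U * Uᵀ) 0) =
        fromBlocks (1 + diagonal (fun i => (a (Sum.inl i) : ℝ)) * (S * Sᵀ)) 0 0
          (1 + diagonal (fun i => (a (Sum.inr i) : ℝ)) * (T * Tᵀ)) := by
      rw [hblk]
      ext i j
      rcases i with i | i <;> rcases j with j | j <;>
        simp [interp, Matrix.one_apply, diagonal_mul]
    rw [hd, det_fromBlocks_zero₂₁, Real.sqrt_mul hS.1.le, mul_inv, ← hS.2, ← hT.2,
      ← integral_prod_mul]
    congr 1
    ext w
    rw [← Real.exp_add, Fintype.sum_sum_type]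
    congr 1
    simp only [Sum.elim_inl, Sum.elim_inr, neg_div, Finset.sum_div]
    rw [neg_add]
    congr 2 <;> exact Finset.sum_congr rfl fun i _ => by ring
  simp_rw [e] at hm
  rw [← hL] at hm
  simp only [Fintype.prod_sum_type, Sum.elim_inl, Sum.elim_inr] at hm
  have h5 := integral_prod_mul (μ := stdG κ) (ν := stdG κ)
    (fun x => ∏ i, ∑ k ∈ Finset.range d, c k * Real.exp (-((S *ᵥ x) i ^ 2 / 2)) ^ k)
    (fun x => ∏ i, ∑ k ∈ Finset.range d, c k * Real.exp (-((T *ᵥ x) i ^ 2 / 2)) ^ k)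
  rw [h5] at hm
  simpa [hU, fromRows_mulVec] using hm

end RoyenPart

section ApproxPart
open Matrix

/-- the approximating polynomials -/
def apPoly (k : ℕ) : Polynomial ℝ :=
  1 - (1 - Polynomial.X ^ k) ^ ⌈(k : ℝ) * Real.exp (k / 2)⌉₊

lemma apPoly_eval (k : ℕ) (y : ℝ) :
    (apPoly k).eval y = 1 - (1 - y ^ k) ^ ⌈(k : ℝ) * Real.exp (k / 2)⌉₊ := by
  simp [apPoly]

lemma apPoly_nonneg (k : ℕ) (y : ℝ) (h0 : 0 ≤ y) (h1 : y ≤ 1) : 0 ≤ (apPoly k).eval y := by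
  rw [apPoly_eval, sub_nonneg]
  have := pow_nonneg h0 k
  exact pow_le_one₀ (sub_nonneg.mpr (pow_le_one₀ h0 h1)) (by linarith)

lemma apPoly_le_one (k : ℕ) (y : ℝ) (h0 : 0 ≤ y) (h1 : y ≤ 1) : (apPoly k).eval y ≤ 1 := by
  rw [apPoly_eval]
  have := pow_nonneg (sub_nonneg.mpr (pow_le_one₀ (n := k) h0 h1)) ⌈(k : ℝ) * Real.exp (k / 2)⌉₊
  linarith

lemma apPoly_deriv (k : ℕ) (y : ℝ) (h0 : 0 ≤ y) (h1 : y ≤ 1) :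
    0 ≤ (apPoly k).derivative.eval y := by
  have h2 := sub_nonneg.mpr (pow_le_one₀ (n := k) h0 h1)
  simp [apPoly, Polynomial.derivative_pow]
  positivity

lemma poly_deriv_sum (P : Polynomial ℝ) (y : ℝ) :
    ∑ k ∈ Finset.range (P.natDegree + 1), P.coeff k * k * y ^ k = y * P.derivative.eval y := by
  rw [Polynomial.derivative_eval, Polynomial.sum_over_range _ (by simp), Finset.mul_sum]
  refine Finset.sum_congr rfl fun k _ => ?_
  rcases k with _ | k
  · simp
  · simp [pow_succ]; ring

lemma apPoly_tendsto (u : ℝ) :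
    Tendsto (fun k => (apPoly k).eval (Real.exp (-(u ^ 2 / 2)))) atTop
      (𝓝 (if |u| ≤ 1 then 1 else 0)) := by
  set y := Real.exp (-(u ^ 2 / 2)) with hy
  have hy0 : 0 < y := Real.exp_pos _
  have hy1 : y ≤ 1 := by rw [hy, Real.exp_le_one_iff]; nlinarith [sq_nonneg u]
  have hM : ∀ k : ℕ, (k : ℝ) * Real.exp (k / 2) ≤ (⌈(k : ℝ) * Real.exp (k / 2)⌉₊ : ℝ) :=
    fun k => Nat.le_ceil _
  have hM' : ∀ k : ℕ, (⌈(k : ℝ) * Real.exp (k / 2)⌉₊ : ℝ) ≤ (k : ℝ) * Real.exp (k / 2) + 1 :=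
    fun k => (Nat.ceil_lt_add_one (by positivity)).le
  split_ifs with hu
  · have hyc : Real.exp (-(1 / 2)) ≤ y := by
      rw [hy, Real.exp_le_exp]
      have := (sq_le_one_iff_abs_le_one u).mpr hu
      linarith
    have hlow : ∀ k : ℕ, 1 - Real.exp (-(k : ℝ)) ≤ (apPoly k).eval y := by
      intro k
      rw [apPoly_eval]
      have e1 : 1 - y ^ k ≤ Real.exp (-(y ^ k)) := by
        have := Real.add_one_le_exp (-(y ^ k)); linarith
      have e2 : (1 - y ^ k) ^ ⌈(k : ℝ) * Real.exp (k / 2)⌉₊ ≤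
          Real.exp (-(y ^ k)) ^ ⌈(k : ℝ) * Real.exp (k / 2)⌉₊ :=
        pow_le_pow_left₀ (sub_nonneg.mpr (pow_le_one₀ hy0.le hy1)) e1 _
      have e3 : Real.exp (-(y ^ k)) ^ ⌈(k : ℝ) * Real.exp (k / 2)⌉₊ ≤ Real.exp (-(k : ℝ)) := by
        rw [← Real.exp_nat_mul, Real.exp_le_exp]
        have e4 : Real.exp (-(1 / 2)) ^ k ≤ y ^ k := pow_le_pow_left₀ (Real.exp_pos _).le hyc k
        have e5 : (k : ℝ) * Real.exp (k / 2) * Real.exp (-(1 / 2)) ^ k = k := by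
          rw [← Real.exp_nat_mul, mul_assoc, ← Real.exp_add]
          have : (k : ℝ) / 2 + k * -(1 / 2) = 0 := by ring
          rw [this]; simp
        have e6 : (k : ℝ) ≤ ⌈(k : ℝ) * Real.exp (k / 2)⌉₊ * y ^ k := by
          calc (k : ℝ) = (k : ℝ) * Real.exp (k / 2) * Real.exp (-(1 / 2)) ^ k := e5.symm
            _ ≤ _ := mul_le_mul (hM k) e4 (by positivity) (by positivity)
        linarith
      linarith
    refine tendsto_of_tendsto_of_tendsto_of_le_of_le (g := fun k : ℕ => 1 - Real.exp (-(k : ℝ)))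
      (h := fun _ => 1) ?_ tendsto_const_nhds hlow (fun k => apPoly_le_one k y hy0.le hy1)
    have : Tendsto (fun k : ℕ => Real.exp (-(k : ℝ))) atTop (𝓝 0) :=
      Real.tendsto_exp_neg_atTop_nhds_zero.comp tendsto_natCast_atTop_atTop
    simpa using tendsto_const_nhds.sub this
  · have hyc : Real.exp (1 / 2) * y < 1 := by
      rw [hy, ← Real.exp_add, Real.exp_lt_one_iff]
      have : 1 < u ^ 2 := (one_lt_sq_iff_one_lt_abs u).mpr (not_le.mp hu)
      linarith
    have hy1' : y < 1 := by
      have : 1 ≤ Real.exp (1 / 2) := Real.one_le_exp (by norm_num)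
      nlinarith
    have hup : ∀ k : ℕ, (apPoly k).eval y ≤ k * (Real.exp (1 / 2) * y) ^ k + y ^ k := by
      intro k
      rw [apPoly_eval]
      have hyk : y ^ k ≤ 1 := pow_le_one₀ hy0.le hy1
      have e1 := one_add_mul_le_pow (a := -(y ^ k)) (by linarith) ⌈(k : ℝ) * Real.exp (k / 2)⌉₊
      have e2 : (⌈(k : ℝ) * Real.exp (k / 2)⌉₊ : ℝ) * y ^ k ≤
          ((k : ℝ) * Real.exp (k / 2) + 1) * y ^ k :=
        mul_le_mul_of_nonneg_right (hM' k) (by positivity)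
      have e3 : Real.exp (k / 2) = Real.exp (1 / 2) ^ k := by
        rw [← Real.exp_nat_mul]; congr 1; ring
      rw [e3] at e2 e1 ⊢
      rw [mul_pow]
      rw [← sub_eq_add_neg] at e1
      nlinarith
    refine tendsto_of_tendsto_of_tendsto_of_le_of_le (g := fun _ => 0)
      tendsto_const_nhds ?_ (fun k => apPoly_nonneg k y hy0.le hy1) hup
    have t1 := tendsto_self_mul_const_pow_of_lt_one (r := Real.exp (1 / 2) * y) (by positivity) hyc
    have t2 := tendsto_pow_atTop_nhds_zero_of_lt_one hy0.le hy1'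
    simpa using t1.add t2

lemma strip_tendsto {ι κ : Type*} [Fintype ι] [Fintype κ] (S : Matrix ι κ ℝ) :
    Tendsto (fun k => ∫ x, ∏ i, (apPoly k).eval (Real.exp (-((S *ᵥ x) i ^ 2 / 2))) ∂(stdG κ)) atTop
      (𝓝 ((stdG κ).real {x | ∀ i, |(S *ᵥ x) i| ≤ 1})) := by
  classical
  have hm : MeasurableSet {x : κ → ℝ | ∀ i, |(S *ᵥ x) i| ≤ 1} := by
    rw [setOf_forall]
    refine MeasurableSet.iInter fun i => ?_
    exact measurableSet_le (continuous_abs.measurable.comp (mulVec_meas S i)) measurable_const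
  rw [← integral_indicator_one hm]
  refine tendsto_integral_of_dominated_convergence (fun _ => 1) ?_ (integrable_const _) ?_ ?_
  · intro k
    refine Measurable.aestronglyMeasurable ?_
    refine Finset.measurable_prod _ fun i _ => ?_
    refine (apPoly k).continuous.measurable.comp (Real.measurable_exp.comp ?_)
    exact (((mulVec_meas S i).pow_const 2).div_const 2).neg
  · intro k
    refine ae_of_all _ fun x => ?_
    have hy1 : ∀ u : ℝ, Real.exp (-(u ^ 2 / 2)) ≤ 1 := by
      intro u; rw [Real.exp_le_one_iff]; nlinarith [sq_nonneg u]
    rw [Real.norm_eq_abs, abs_of_nonneg]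
    · exact Finset.prod_le_one (fun i _ => apPoly_nonneg _ _ (Real.exp_pos _).le (hy1 _))
        (fun i _ => apPoly_le_one _ _ (Real.exp_pos _).le (hy1 _))
    · exact Finset.prod_nonneg (fun i _ => apPoly_nonneg _ _ (Real.exp_pos _).le (hy1 _))
  · refine ae_of_all _ fun x => ?_
    have h := tendsto_finsetProd (Finset.univ : Finset ι)
      (fun i _ => apPoly_tendsto ((S *ᵥ x) i))
    convert h using 2
    by_cases hx : ∀ i, |(S *ᵥ x) i| ≤ 1
    · rw [indicator_of_mem (by exact hx)]
      simp [hx]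
    · rw [indicator_of_notMem (by exact hx)]
      push Not at hx
      obtain ⟨i, hi⟩ := hx
      exact (Finset.prod_eq_zero (Finset.mem_univ i) (by simp [not_le.mpr hi])).symm

lemma strip_gci {m n κ : Type*} [Fintype m] [Fintype n] [DecidableEq m] [DecidableEq n]
    [Fintype κ] [DecidableEq κ] (S : Matrix m κ ℝ) (T : Matrix n κ ℝ) :
    stdG κ {x | ∀ i, |(S *ᵥ x) i| ≤ 1} * stdG κ {x | ∀ i, |(T *ᵥ x) i| ≤ 1} ≤
      stdG κ ({x | ∀ i, |(S *ᵥ x) i| ≤ 1} ∩ {x | ∀ i, |(T *ᵥ x) i| ≤ 1}) := by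
  have h := strip_tendsto (fromRows S T)
  have hset : {x | ∀ i, |(fromRows S T *ᵥ x) i| ≤ 1} =
      {x | ∀ i, |(S *ᵥ x) i| ≤ 1} ∩ {x | ∀ i, |(T *ᵥ x) i| ≤ 1} := by
    ext x; simp [fromRows_mulVec]
  rw [hset] at h
  have hle := le_of_tendsto_of_tendsto' ((strip_tendsto S).mul (strip_tendsto T)) h (by
    intro k
    have := royen_poly S T ((apPoly k).natDegree + 1) (apPoly k).coeff
      (by intro y h0 h1; rw [← Polynomial.eval_eq_sum_range]; exact apPoly_nonneg k y h0 h1)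
      (by intro y h0 h1; rw [poly_deriv_sum]; exact mul_nonneg h0 (apPoly_deriv k y h0 h1))
    simp_rw [← Polynomial.eval_eq_sum_range] at this
    simpa [fromRows_mulVec] using this)
  rw [measureReal_def, measureReal_def, measureReal_def, ← ENNReal.toReal_mul] at hle
  exact (ENNReal.toReal_le_toReal (ENNReal.mul_ne_top (measure_ne_top _ _) (measure_ne_top _ _))
    (measure_ne_top _ _)).mp hle

end ApproxPart

section ConvexPart
open Matrix

/-- symmetric convex sets -/
def SC {E : Type*} [AddCommGroup E] [Module ℝ E] (A : Set E) : Prop :=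
  Convex ℝ A ∧ ∀ x ∈ A, -x ∈ A

lemma SC.inter {E : Type*} [AddCommGroup E] [Module ℝ E] {A B : Set E} (hA : SC A) (hB : SC B) :
    SC (A ∩ B) := ⟨hA.1.inter hB.1, fun x hx => ⟨hA.2 x hx.1, hB.2 x hx.2⟩⟩

lemma SC.zero_mem {E : Type*} [AddCommGroup E] [Module ℝ E] {A : Set E} (hA : SC A)
    (hne : A.Nonempty) : (0 : E) ∈ A := by
  obtain ⟨x, hx⟩ := hne
  have hc : Convex ℝ A := hA.1
  have := hc hx (hA.2 x hx) (show (0 : ℝ) ≤ 1 / 2 by norm_num) (show (0 : ℝ) ≤ 1 / 2 by norm_num)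
    (by norm_num)
  simpa using this

variable {κ : Type*} [Fintype κ]

lemma closed_strips [DecidableEq κ] {A : Set (κ → ℝ)} (hA : SC A) (hc : IsClosed A)
    (hne : A.Nonempty) :
    ∃ a : ℕ → κ → ℝ, A = ⋂ k : ℕ, {x | ∀ i : Fin k, |(Matrix.of (fun i : Fin k => a i) *ᵥ x) i| ≤ 1} := by
  let V : Set (κ → ℝ) := {v | ∀ x ∈ A, |v ⬝ᵥ x| ≤ 1}
  have hopen : ∀ v : V, IsOpen {y : κ → ℝ | 1 < |v.1 ⬝ᵥ y|} := by
    intro v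
    refine isOpen_lt continuous_const (continuous_abs.comp ?_)
    unfold dotProduct
    fun_prop
  obtain ⟨T, hTc, hT⟩ := TopologicalSpace.isOpen_iUnion_countable
    (fun v : V => {y : κ → ℝ | 1 < |v.1 ⬝ᵥ y|}) hopen
  have h0V : (0 : κ → ℝ) ∈ V := by intro x _; simp
  obtain ⟨a, ha⟩ := ((hTc.image Subtype.val).insert (0 : κ → ℝ)).exists_eq_range
    (insert_nonempty _ _)
  have hsep : ∀ x ∉ A, ∃ v ∈ V, 1 < |v ⬝ᵥ x| := by
    intro x hx
    obtain ⟨f, u, hfa, hfx⟩ := geometric_hahn_banach_closed_point hA.1 hc hx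
    have hu : 0 < u := by simpa using hfa 0 (hA.zero_mem hne)
    have hrep : ∀ y, (fun j => f (Pi.single j 1) / u) ⬝ᵥ y = f y / u := by
      intro y
      conv_rhs => rw [← Finset.univ_sum_single y]
      rw [map_sum, Finset.sum_div]
      refine Finset.sum_congr rfl fun j _ => ?_
      have : Pi.single j (y j) = (y j) • (Pi.single j 1 : κ → ℝ) := by
        rw [← Pi.single_smul]; simp
      rw [this, map_smul, smul_eq_mul]; ring
    refine ⟨fun j => f (Pi.single j 1) / u, ?_, ?_⟩
    · intro y hy
      rw [hrep, abs_le, le_div_iff₀ hu, div_le_iff₀ hu]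
      have h1 := hfa y hy
      have h2 := hfa (-y) (hA.2 y hy)
      rw [map_neg] at h2
      constructor <;> linarith
    · rw [hrep]
      exact lt_of_lt_of_le ((one_lt_div hu).mpr hfx) (le_abs_self _)
  refine ⟨a, ?_⟩
  have hav : ∀ k, a k ∈ V := by
    intro k
    have : a k ∈ range a := ⟨k, rfl⟩
    rw [← ha] at this
    rcases this with h | ⟨v, _, h⟩
    · rw [h]; exact h0V
    · rw [← h]; exact v.2
  ext x
  simp only [mem_iInter, mem_setOf_eq]
  constructor
  · intro hx k i
    exact hav i x hx
  · intro h
    by_contra hx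
    obtain ⟨v, hv, hvx⟩ := hsep x hx
    have hmem : x ∈ ⋃ v : V, {y : κ → ℝ | 1 < |v.1 ⬝ᵥ y|} := mem_iUnion.mpr ⟨⟨v, hv⟩, hvx⟩
    rw [← hT] at hmem
    simp only [mem_iUnion, mem_setOf_eq] at hmem
    obtain ⟨w, hwT, hw⟩ := hmem
    have : w.1 ∈ range a := by
      rw [← ha]; exact Or.inr ⟨w, hwT, rfl⟩
    obtain ⟨k, hk⟩ := this
    have h2 := h (k + 1) ⟨k, Nat.lt_succ_self k⟩
    have h3 : |a k ⬝ᵥ x| ≤ 1 := h2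
    rw [hk] at h3
    linarith

lemma strip_meas {ι : Type*} [Fintype ι] (S : Matrix ι κ ℝ) :
    MeasurableSet {x : κ → ℝ | ∀ i, |(S *ᵥ x) i| ≤ 1} := by
  have : {x : κ → ℝ | ∀ i, |(S *ᵥ x) i| ≤ 1} = ⋂ i, {x : κ → ℝ | |(S *ᵥ x) i| ≤ 1} := by
    ext x; simp
  rw [this]
  refine MeasurableSet.iInter fun i => ?_
  exact measurableSet_le (continuous_abs.measurable.comp (mulVec_meas S i)) measurable_const

lemma gci_closed [DecidableEq κ] {A B : Set (κ → ℝ)} (hA : SC A) (hAc : IsClosed A)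
    (hAne : A.Nonempty) (hB : SC B) (hBc : IsClosed B) (hBne : B.Nonempty) :
    stdG κ A * stdG κ B ≤ stdG κ (A ∩ B) := by
  obtain ⟨a, ha⟩ := closed_strips hA hAc hAne
  obtain ⟨b, hb⟩ := closed_strips hB hBc hBne
  let Z : (ℕ → κ → ℝ) → ℕ → Set (κ → ℝ) := fun a k =>
    {x | ∀ i : Fin k, |(Matrix.of (fun i : Fin k => a i) *ᵥ x) i| ≤ 1}
  have hZm : ∀ a k, MeasurableSet (Z a k) := fun a k => strip_meas _
  have hZa : ∀ a, Antitone (Z a) := by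
    intro a k l hkl x hx i
    exact hx ⟨i, i.2.trans_le hkl⟩
  have tA : Tendsto (fun k => stdG κ (Z a k)) atTop (𝓝 (stdG κ A)) := by
    rw [ha]
    exact tendsto_measure_iInter_atTop (fun k => (hZm a k).nullMeasurableSet) (hZa a)
      ⟨0, measure_ne_top _ _⟩
  have tB : Tendsto (fun k => stdG κ (Z b k)) atTop (𝓝 (stdG κ B)) := by
    rw [hb]
    exact tendsto_measure_iInter_atTop (fun k => (hZm b k).nullMeasurableSet) (hZa b)
      ⟨0, measure_ne_top _ _⟩
  have tAB : Tendsto (fun k => stdG κ (Z a k ∩ Z b k)) atTop (𝓝 (stdG κ (A ∩ B))) := by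
    have : A ∩ B = ⋂ k, (Z a k ∩ Z b k) := by
      rw [iInter_inter_distrib]
      exact congrArg₂ (· ∩ ·) ha hb
    rw [this]
    exact tendsto_measure_iInter_atTop (fun k => ((hZm a k).inter (hZm b k)).nullMeasurableSet)
      (fun k l hkl => inter_subset_inter (hZa a hkl) (hZa b hkl)) ⟨0, measure_ne_top _ _⟩
  refine le_of_tendsto_of_tendsto' (ENNReal.Tendsto.mul tA (Or.inr (measure_ne_top _ _)) tB
    (Or.inr (measure_ne_top _ _))) tAB fun k => ?_
  exact strip_gci _ _

lemma convex_ae_closure {A : Set (κ → ℝ)} (hA : Convex ℝ A) : A =ᵐ[stdG κ] closure A := by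
  have h0 : stdG κ (frontier A) = 0 := stdG_ac κ (hA.addHaar_frontier volume)
  refine (subset_closure.eventuallyLE).antisymm ?_
  rw [ae_le_set]
  refine measure_mono_null ?_ h0
  intro x hx
  exact ⟨hx.1, fun h => hx.2 (interior_subset h)⟩

lemma SC.nullMeas {A : Set (κ → ℝ)} (hA : SC A) : NullMeasurableSet A (stdG κ) :=
  isClosed_closure.measurableSet.nullMeasurableSet.congr (convex_ae_closure hA.1).symm

lemma SC.closure {A : Set (κ → ℝ)} (hA : SC A) : SC (closure A) := by
  refine ⟨hA.1.closure, fun x hx => ?_⟩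
  exact map_mem_closure continuous_neg hx hA.2

lemma gci_std {A B : Set (κ → ℝ)} (hA : SC A) (hB : SC B) :
    stdG κ A * stdG κ B ≤ stdG κ (A ∩ B) := by
  classical
  rcases A.eq_empty_or_nonempty with rfl | hAne
  · simp
  rcases B.eq_empty_or_nonempty with rfl | hBne
  · simp
  rw [measure_congr (convex_ae_closure hA.1), measure_congr (convex_ae_closure hB.1),
    measure_congr ((convex_ae_closure hA.1).inter (convex_ae_closure hB.1))]
  exact gci_closed hA.closure isClosed_closure hAne.closure hB.closure isClosed_closure hBne.closure

end ConvexPart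

section LayerPart

lemma vol_layer (c : ℝ≥0∞) : volume.restrict (Ioi (0 : ℝ)) {t | ENNReal.ofReal t < c} = c := by
  have hm : MeasurableSet {t : ℝ | ENNReal.ofReal t < c} :=
    measurableSet_lt ENNReal.measurable_ofReal measurable_const
  rw [Measure.restrict_apply hm]
  by_cases hc : c = ⊤
  · subst hc
    simp
  · have : {t | ENNReal.ofReal t < c} ∩ Ioi (0 : ℝ) = Ioo 0 c.toReal := by
      ext t
      simp only [mem_inter_iff, mem_setOf_eq, mem_Ioi, mem_Ioo]
      constructor
      · rintro ⟨h1, h2⟩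
        exact ⟨h2, (ENNReal.ofReal_lt_iff_lt_toReal h2.le hc).mp h1⟩
      · rintro ⟨h1, h2⟩
        exact ⟨(ENNReal.ofReal_lt_iff_lt_toReal h1.le hc).mpr h2, h1⟩
    rw [this, Real.volume_Ioo, sub_zero, ENNReal.ofReal_toReal hc]

lemma layer {E : Type*} [MeasurableSpace E] (ν : Measure E) [SFinite ν] {H f : E → ℝ≥0∞}
    (hH : AEMeasurable H ν) (hf : AEMeasurable f ν) :
    ∫⁻ x, H x * f x ∂ν =
      ∫⁻ t in Ioi (0 : ℝ), ∫⁻ x, {x | ENNReal.ofReal t < f x}.indicator H x ∂ν := by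
  have hR : ∀ t : ℝ, ∫⁻ x, {x | ENNReal.ofReal t < f x}.indicator H x ∂ν =
      ∫⁻ x, {x | ENNReal.ofReal t < hf.mk f x}.indicator (hH.mk H) x ∂ν := by
    intro t
    refine lintegral_congr_ae ?_
    filter_upwards [hf.ae_eq_mk, hH.ae_eq_mk] with x h1 h2
    simp only [indicator, mem_setOf_eq, h1, h2]
  simp_rw [hR]
  have hL : ∫⁻ x, H x * f x ∂ν = ∫⁻ x, hH.mk H x * hf.mk f x ∂ν := by
    refine lintegral_congr_ae ?_
    filter_upwards [hf.ae_eq_mk, hH.ae_eq_mk] with x h1 h2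
    rw [h1, h2]
  rw [hL]
  have hmf := hf.measurable_mk
  have hmH := hH.measurable_mk
  rw [lintegral_lintegral_swap]
  · refine lintegral_congr fun x => ?_
    have : ∀ t : ℝ, {x | ENNReal.ofReal t < hf.mk f x}.indicator (hH.mk H) x =
        {t : ℝ | ENNReal.ofReal t < hf.mk f x}.indicator (fun _ => hH.mk H x) t := by
      intro t; simp only [indicator, mem_setOf_eq]
    simp_rw [this]
    rw [lintegral_indicator_const (measurableSet_lt ENNReal.measurable_ofReal measurable_const),
      vol_layer]
  · refine Measurable.aemeasurable ?_
    have : (Function.uncurry fun (t : ℝ) x =>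
        {x | ENNReal.ofReal t < hf.mk f x}.indicator (hH.mk H) x) =
        {p : ℝ × E | ENNReal.ofReal p.1 < hf.mk f p.2}.indicator (fun p => hH.mk H p.2) := by
      ext ⟨t, x⟩
      simp only [Function.uncurry, indicator, mem_setOf_eq]
    rw [this]
    refine (hmH.comp measurable_snd).indicator ?_
    exact measurableSet_lt (ENNReal.measurable_ofReal.comp measurable_fst) (hmf.comp measurable_snd)

variable {κ : Type*} [Fintype κ]

/-- symmetric quasiconcave functions -/
def QS (f : (κ → ℝ) → ℝ≥0∞) : Prop := ∀ c, SC {x | c < f x}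

lemma aemeas_of_null {f : (κ → ℝ) → ℝ≥0∞}
    (hf : ∀ c, NullMeasurableSet {x | c < f x} (stdG κ)) : AEMeasurable f (stdG κ) := by
  have : NullMeasurable f (stdG κ) := by
    have h : @Measurable (NullMeasurableSpace (κ → ℝ) (stdG κ)) ℝ≥0∞ _ _ f :=
      measurable_of_Ioi (fun c => hf c)
    intro s hs
    exact h hs
  exact this.aemeasurable

lemma QS.aemeas {f : (κ → ℝ) → ℝ≥0∞} (hf : QS f) : AEMeasurable f (stdG κ) :=
  aemeas_of_null fun c => (hf c).nullMeas

lemma prod_aemeas {ι : Type*} (f : ι → (κ → ℝ) → ℝ≥0∞) (hf : ∀ i, QS (f i)) (s : Finset ι) :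
    AEMeasurable (fun x => ∏ i ∈ s, f i x) (stdG κ) :=
  Finset.aemeasurable_fun_prod s fun i _ => (hf i).aemeas

lemma ind_lower {ι : Type*} [DecidableEq ι] (f : ι → (κ → ℝ) → ℝ≥0∞) (hf : ∀ i, QS (f i))
    (H : (κ → ℝ) → ℝ≥0∞) (hH : AEMeasurable H (stdG κ)) (K : ℝ≥0∞)
    (hK : ∀ A, SC A → K * stdG κ A ≤ ∫⁻ x, A.indicator H x ∂(stdG κ)) (s : Finset ι) :
    ∀ A, SC A → K * ∫⁻ x, A.indicator (fun x => ∏ i ∈ s, f i x) x ∂(stdG κ) ≤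
      ∫⁻ x, A.indicator (fun x => H x * ∏ i ∈ s, f i x) x ∂(stdG κ) := by
  induction s using Finset.induction_on with
  | empty =>
    intro A hA
    have h1 : ∫⁻ x, A.indicator (fun _ => (1 : ℝ≥0∞)) x ∂(stdG κ) = stdG κ A :=
      lintegral_indicator_one₀ hA.nullMeas
    simp only [Finset.prod_empty, mul_one]
    rw [h1]
    exact hK A hA
  | insert j s hj ih =>
    intro A hA
    have e1 : ∀ x, A.indicator (fun x => ∏ i ∈ insert j s, f i x) x =
        A.indicator (fun x => ∏ i ∈ s, f i x) x * f j x := by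
      intro x
      by_cases hx : x ∈ A <;> simp [hx, Finset.prod_insert hj, mul_comm]
    have e2 : ∀ x, A.indicator (fun x => H x * ∏ i ∈ insert j s, f i x) x =
        A.indicator (fun x => H x * ∏ i ∈ s, f i x) x * f j x := by
      intro x
      by_cases hx : x ∈ A
      · simp only [hx, indicator_of_mem, Finset.prod_insert hj]; ring
      · simp [hx]
    simp_rw [e1, e2]
    have hm : AEMeasurable (fun x => H x * ∏ i ∈ s, f i x) (stdG κ) :=
      hH.mul (prod_aemeas f hf s)
    rw [layer _ ((prod_aemeas f hf s).indicator₀ hA.nullMeas) (hf j).aemeas,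
      layer _ (hm.indicator₀ hA.nullMeas) (hf j).aemeas]
    refine (lintegral_const_mul_le _ _).trans (lintegral_mono fun t => ?_)
    simp_rw [indicator_indicator]
    exact ih _ ((hf j _).inter hA)

lemma ind_upper {ι : Type*} [DecidableEq ι] (f : ι → (κ → ℝ) → ℝ≥0∞) (hf : ∀ i, QS (f i))
    (H : (κ → ℝ) → ℝ≥0∞) (hH : AEMeasurable H (stdG κ)) (K : ℝ≥0∞) (hKt : K ≠ ⊤)
    (hK : ∀ A, SC A → ∫⁻ x, A.indicator H x ∂(stdG κ) ≤ K * stdG κ A) (s : Finset ι) :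
    ∀ A, SC A → ∫⁻ x, A.indicator (fun x => H x * ∏ i ∈ s, f i x) x ∂(stdG κ) ≤
      K * ∫⁻ x, A.indicator (fun x => ∏ i ∈ s, f i x) x ∂(stdG κ) := by
  induction s using Finset.induction_on with
  | empty =>
    intro A hA
    have h1 : ∫⁻ x, A.indicator (fun _ => (1 : ℝ≥0∞)) x ∂(stdG κ) = stdG κ A :=
      lintegral_indicator_one₀ hA.nullMeas
    simp only [Finset.prod_empty, mul_one]
    rw [h1]
    exact hK A hA
  | insert j s hj ih =>
    intro A hA
    have e1 : ∀ x, A.indicator (fun x => ∏ i ∈ insert j s, f i x) x =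
        A.indicator (fun x => ∏ i ∈ s, f i x) x * f j x := by
      intro x
      by_cases hx : x ∈ A <;> simp [hx, Finset.prod_insert hj, mul_comm]
    have e2 : ∀ x, A.indicator (fun x => H x * ∏ i ∈ insert j s, f i x) x =
        A.indicator (fun x => H x * ∏ i ∈ s, f i x) x * f j x := by
      intro x
      by_cases hx : x ∈ A
      · simp only [hx, indicator_of_mem, Finset.prod_insert hj]; ring
      · simp [hx]
    simp_rw [e1, e2]
    have hm : AEMeasurable (fun x => H x * ∏ i ∈ s, f i x) (stdG κ) :=
      hH.mul (prod_aemeas f hf s)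
    rw [layer _ ((prod_aemeas f hf s).indicator₀ hA.nullMeas) (hf j).aemeas,
      layer _ (hm.indicator₀ hA.nullMeas) (hf j).aemeas]
    rw [← lintegral_const_mul' _ _ hKt]
    refine lintegral_mono fun t => ?_
    simp_rw [indicator_indicator]
    exact ih _ ((hf j _).inter hA)

lemma SC_univ : SC (univ : Set (κ → ℝ)) := ⟨convex_univ, fun _ _ => mem_univ _⟩

lemma two_prod {ι : Type*} [DecidableEq ι] (f : ι → (κ → ℝ) → ℝ≥0∞) (hf : ∀ i, QS (f i))
    (s t : Finset ι) :
    (∫⁻ x, ∏ i ∈ s, f i x ∂(stdG κ)) * ∫⁻ x, ∏ i ∈ t, f i x ∂(stdG κ) ≤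
      ∫⁻ x, (∏ i ∈ s, f i x) * ∏ i ∈ t, f i x ∂(stdG κ) := by
  have h1 : ∀ B, SC B → (∫⁻ x, ∏ i ∈ s, f i x ∂(stdG κ)) * stdG κ B ≤
      ∫⁻ x, B.indicator (fun x => ∏ i ∈ s, f i x) x ∂(stdG κ) := by
    intro B hB
    have := ind_lower f hf (B.indicator 1) ((aemeasurable_const (b := (1 : ℝ≥0∞))).indicator₀ hB.nullMeas)
      (stdG κ B) (by
        intro A hA
        rw [indicator_indicator, lintegral_indicator_one₀ (hA.inter hB).nullMeas, inter_comm]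
        exact gci_std hB hA) s univ SC_univ
    simp only [indicator_univ] at this
    rw [mul_comm]
    refine this.trans (le_of_eq (lintegral_congr fun x => ?_))
    by_cases hx : x ∈ B <;> simp [hx]
  have := ind_lower f hf _ (prod_aemeas f hf s) _ h1 t univ SC_univ
  simpa only [indicator_univ] using this

lemma compl_prod {ι : Type*} [DecidableEq ι] (f : ι → (κ → ℝ) → ℝ≥0∞) (hf : ∀ i, QS (f i))
    (s : Finset ι) (g : (κ → ℝ) → ℝ≥0∞) (hg : ∀ c, SC {x | g x ≤ c}) :
    ∫⁻ x, (∏ i ∈ s, f i x) * g x ∂(stdG κ) ≤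
      (∫⁻ x, ∏ i ∈ s, f i x ∂(stdG κ)) * ∫⁻ x, g x ∂(stdG κ) := by
  have hset : ∀ c, {x | c < g x} = {x | g x ≤ c}ᶜ := by intro c; ext x; simp
  have hgm : AEMeasurable g (stdG κ) := aemeas_of_null fun c => by
    rw [hset]; exact (hg c).nullMeas.compl
  have hB : ∀ c, ∫⁻ x, {x | c < g x}.indicator (fun x => ∏ i ∈ s, f i x) x ∂(stdG κ) ≤
      stdG κ {x | c < g x} * ∫⁻ x, ∏ i ∈ s, f i x ∂(stdG κ) := by
    intro c
    have hn : NullMeasurableSet {x | c < g x} (stdG κ) := by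
      rw [hset]; exact (hg c).nullMeas.compl
    have := ind_upper f hf ({x | c < g x}.indicator 1)
      ((aemeasurable_const (b := (1 : ℝ≥0∞))).indicator₀ hn)
      (stdG κ {x | c < g x}) (measure_ne_top _ _) (by
        intro A hA
        rw [indicator_indicator, lintegral_indicator_one₀ (hA.nullMeas.inter hn), hset,
          prob_compl_eq_one_sub₀ (hg c).nullMeas, ENNReal.sub_mul (fun _ _ => measure_ne_top _ _),
          one_mul, mul_comm]
        have hd : stdG κ (A ∩ {x | g x ≤ c}) + stdG κ (A ∩ {x | g x ≤ c}ᶜ) = stdG κ A :=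
          measure_inter_add_diff₀ A (hg c).nullMeas
        have hgci := gci_std hA (hg c)
        refine ENNReal.le_sub_of_add_le_left (ENNReal.mul_ne_top (measure_ne_top _ _)
          (measure_ne_top _ _)) ?_
        rw [← hd]
        conv_lhs => rw [hd]
        gcongr) s univ SC_univ
    simp only [indicator_univ] at this
    refine (le_of_eq (lintegral_congr fun x => ?_)).trans this
    by_cases hx : c < g x <;> simp [hx]
  have h1 : ∫⁻ x, g x ∂(stdG κ) = ∫⁻ t in Ioi (0 : ℝ), stdG κ {x | ENNReal.ofReal t < g x} := by
    have := layer (stdG κ) (H := 1) (aemeasurable_const (b := (1 : ℝ≥0∞))) hgm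
    simp only [Pi.one_apply, one_mul] at this
    rw [this]
    refine lintegral_congr fun t => ?_
    rw [lintegral_indicator_one₀]
    rw [hset]; exact (hg _).nullMeas.compl
  rw [layer _ (prod_aemeas f hf s) hgm, h1, mul_comm, ← lintegral_mul_const]
  · exact lintegral_mono fun t => hB _
  · refine Antitone.measurable ?_
    intro t u htu
    exact measure_mono fun x hx => lt_of_le_of_lt (ENNReal.ofReal_le_ofReal htu) hx

lemma many_prod {m k : ℕ} (f : Fin m → (κ → ℝ) → ℝ≥0∞) (hf : ∀ i, QS (f i)) (J : Fin m → Fin k)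
    (I : Finset (Fin k)) :
    ∏ i ∈ I, (∫⁻ x, ∏ j ∈ Finset.univ.filter (fun j => J j = i), f j x ∂(stdG κ)) ≤
      ∫⁻ x, ∏ j ∈ Finset.univ.filter (fun j => J j ∈ I), f j x ∂(stdG κ) := by
  induction I using Finset.induction_on with
  | empty => simp
  | insert a I ha ih =>
    rw [Finset.prod_insert ha]
    refine (mul_le_mul_right ih _).trans ((two_prod f hf _ _).trans (le_of_eq ?_))
    refine lintegral_congr fun x => ?_
    rw [← Finset.prod_union]
    · refine Finset.prod_congr ?_ fun _ _ => rfl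
      ext j; simp
    · rw [Finset.disjoint_filter]
      intro j _ h1 h2
      exact ha (h1 ▸ h2)

end LayerPart

section Reduction
open Matrix Complex

lemma charFunDual_stdG_map {n : ℕ} {κ : Type*} [Fintype κ] (T : Matrix (Fin n) κ ℝ)
    (L : StrongDual ℝ (Fin n → ℝ)) (c : Fin n → ℝ) (hc : ∀ x, L x = c ⬝ᵥ x) :
    charFunDual ((stdG κ).map (fun y => T *ᵥ y)) L =
      Complex.exp (-((c ᵥ* T ⬝ᵥ c ᵥ* T : ℝ) : ℂ) / 2) := by
  have hm : Measurable (fun y : κ → ℝ => T *ᵥ y) :=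
    (Continuous.matrix_mulVec continuous_const continuous_id).measurable
  rw [charFunDual_apply, integral_map hm.aemeasurable (by fun_prop)]
  have e : ∀ y : κ → ℝ, Complex.exp ((L (T *ᵥ y) : ℂ) * I) =
      ∏ j, Complex.exp (((c ᵥ* T) j : ℂ) * (y j : ℂ) * I) := by
    intro y
    rw [hc, dotProduct_mulVec, ← Complex.exp_sum, dotProduct]
    push_cast
    rw [Finset.sum_mul]
  simp_rw [e]
  rw [integral_fintype_prod_eq_prod (μ := fun _ : κ => gaussianReal 0 1)
    (fun j (t : ℝ) => Complex.exp (((c ᵥ* T) j : ℂ) * (t : ℂ) * I))]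
  have e2 : ∀ j, ∫ t : ℝ, Complex.exp (((c ᵥ* T) j : ℂ) * (t : ℂ) * I) ∂(gaussianReal 0 1) =
      Complex.exp (-((c ᵥ* T) j : ℂ) * ((c ᵥ* T) j : ℂ) / 2) := by
    intro j
    rw [← charFun_apply_real, charFun_gaussianReal]
    congr 1
    simp
    ring
  simp_rw [e2]
  rw [← Complex.exp_sum, dotProduct]
  congr 1
  push_cast
  rw [← Finset.sum_neg_distrib, Finset.sum_div]
  simp

lemma charFunDual_centered {n : ℕ} {μ : Measure (Fin n → ℝ)} (hμ : IsCenteredGaussian μ)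
    (L : StrongDual ℝ (Fin n → ℝ)) :
    charFunDual μ L = Complex.exp (-((Var[L; μ] : ℝ) : ℂ) / 2) ∧ MemLp L 2 μ := by
  obtain ⟨v, hv⟩ := hμ.2 L.toLinearMap
  have hv' : μ.map L = gaussianReal 0 v := hv
  have hm : AEMeasurable L μ := by fun_prop
  have hvar : Var[L; μ] = v := by
    have := variance_map (μ := μ) (Y := L) (X := id) (by fun_prop) hm
    rw [hv'] at this
    simpa using this.symm
  constructor
  · rw [charFunDual_eq_charFun_map_one, hv', charFun_gaussianReal, hvar]
    simp [neg_div]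
  · have : MemLp id 2 (μ.map L) := by
      rw [hv']; exact memLp_id_gaussianReal 2
    exact (memLp_map_measure_iff (by fun_prop) hm).mp this

lemma psd_injective_factor {n : ℕ} {S : Matrix (Fin n) (Fin n) ℝ} (hS : S.PosSemidef) :
    ∃ (p : Fin n → Prop) (_ : DecidablePred p) (T : Matrix (Fin n) {j // p j} ℝ),
      T * Tᵀ = S ∧ Function.Injective (fun y => T *ᵥ y) := by
  classical
  let lam := hS.1.eigenvalues
  let U : Matrix (Fin n) (Fin n) ℝ := hS.1.eigenvectorUnitary
  have hU : Uᵀ * U = 1 := by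
    have := (Matrix.mem_unitaryGroup_iff'.mp (hS.1.eigenvectorUnitary).2)
    simpa [Matrix.star_eq_conjTranspose] using this
  have hSp : S = U * diagonal lam * Uᵀ := by
    have := hS.1.spectral_theorem
    rw [Unitary.conjStarAlgAut_apply] at this
    simpa [Matrix.star_eq_conjTranspose] using this
  have hlam : ∀ j, 0 ≤ lam j := hS.eigenvalues_nonneg
  refine ⟨fun j => lam j ≠ 0, inferInstance,
    Matrix.of fun i j => U i j.1 * Real.sqrt (lam j.1), ?_, ?_⟩
  · conv_rhs => rw [hSp]
    ext i k
    rw [Matrix.mul_apply, Matrix.mul_apply]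
    simp only [Matrix.mul_diagonal, of_apply, transpose_apply]
    have : ∀ j, U i j * lam j * U k j = (U i j * Real.sqrt (lam j)) * (U k j * Real.sqrt (lam j)) := by
      intro j
      have := Real.mul_self_sqrt (hlam j)
      linear_combination (-(U i j * U k j)) * this
    simp_rw [this]
    symm
    rw [← Finset.sum_subtype (p := fun j => lam j ≠ 0) (Finset.univ.filter fun j => lam j ≠ 0)
      (by simp) (fun j => (U i j * Real.sqrt (lam j)) * (U k j * Real.sqrt (lam j)))]
    rw [Finset.sum_filter_of_ne]
    intro j _ hj h0
    apply hj
    simp [h0]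
  · intro y z hyz
    set T : Matrix (Fin n) {j // lam j ≠ 0} ℝ :=
      Matrix.of fun i j => U i j.1 * Real.sqrt (lam j.1) with hTdef
    have hTz : T *ᵥ (y - z) = 0 := by
      rw [Matrix.mulVec_sub, sub_eq_zero]; exact hyz
    have key : ∀ j : {j // lam j ≠ 0}, (Uᵀ *ᵥ (T *ᵥ (y - z))) j.1 =
        Real.sqrt (lam j.1) * (y - z) j := by
      intro j
      have hent : ∀ k : {j // lam j ≠ 0}, (Uᵀ * T) j.1 k =
          (if j = k then Real.sqrt (lam j.1) else 0) := by
        intro k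
        have h1 : (Uᵀ * T) j.1 k = (Uᵀ * U) j.1 k.1 * Real.sqrt (lam k.1) := by
          simp only [Matrix.mul_apply, hTdef, of_apply, transpose_apply, Finset.sum_mul]
          exact Finset.sum_congr rfl fun l _ => by ring
        rw [h1, hU, Matrix.one_apply]
        by_cases hjk : j = k
        · subst hjk; simp
        · have : j.1 ≠ k.1 := fun h => hjk (Subtype.ext h)
          simp [hjk, this]
      rw [Matrix.mulVec_mulVec, mulVec, dotProduct]
      simp_rw [hent]
      simp
    ext j
    have h := key j
    rw [hTz] at h
    simp only [mulVec_zero, Pi.zero_apply, Pi.sub_apply] at h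
    have hpos : 0 < Real.sqrt (lam j.1) := Real.sqrt_pos.mpr (lt_of_le_of_ne (hlam _) (Ne.symm j.2))
    have := (mul_eq_zero.mp h.symm).resolve_left hpos.ne'
    linarith

lemma gauss_repr {n : ℕ} {μ : Measure (Fin n → ℝ)} (hμ : IsCenteredGaussian μ) :
    ∃ (p : Fin n → Prop) (_ : DecidablePred p) (T : Matrix (Fin n) {j // p j} ℝ),
      Function.Injective (fun y => T *ᵥ y) ∧
      μ = (stdG {j // p j}).map (fun y => T *ᵥ y) := by
  haveI := hμ.1
  have hmem : ∀ i, MemLp (fun x : Fin n → ℝ => x i) 2 μ := fun i =>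
    (charFunDual_centered hμ (ContinuousLinearMap.proj i)).2
  let S : Matrix (Fin n) (Fin n) ℝ := Matrix.of fun i j =>
    cov[fun x : Fin n → ℝ => x i, fun x => x j; μ]
  have hvar : ∀ c : Fin n → ℝ, Var[fun x => c ⬝ᵥ x; μ] = c ⬝ᵥ S *ᵥ c := by
    intro c
    have hmx : Measurable (fun x : Fin n → ℝ => c ⬝ᵥ x) :=
      (Continuous.dotProduct continuous_const continuous_id).measurable
    rw [← covariance_self hmx.aemeasurable]
    simp only [dotProduct]
    rw [covariance_fun_sum_fun_sum (fun i => (hmem i).const_mul _) (fun i => (hmem i).const_mul _)]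
    refine Finset.sum_congr rfl fun i _ => ?_
    rw [mulVec, dotProduct, Finset.mul_sum]
    refine Finset.sum_congr rfl fun j _ => ?_
    rw [covariance_const_mul_left, covariance_const_mul_right]
    simp only [S, of_apply]
    ring
  have hS : S.PosSemidef := by
    refine Matrix.PosSemidef.of_dotProduct_mulVec_nonneg ?_ ?_
    · ext i j
      simp only [S, conjTranspose_apply, of_apply, star_trivial]
      exact covariance_comm _ _
    · intro c
      rw [star_trivial, ← hvar]
      exact variance_nonneg _ _
  obtain ⟨p, hp, T, hT, hinj⟩ := psd_injective_factor hS
  refine ⟨p, hp, T, hinj, ?_⟩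
  have hm : Measurable (fun y : {j // p j} → ℝ => T *ᵥ y) :=
    (Continuous.matrix_mulVec continuous_const continuous_id).measurable
  haveI : IsProbabilityMeasure ((stdG {j // p j}).map (fun y => T *ᵥ y)) :=
    Measure.isProbabilityMeasure_map hm.aemeasurable
  refine Measure.ext_of_charFunDual ?_
  ext L
  let c : Fin n → ℝ := fun j => L (Pi.single j 1)
  have hc : ∀ x, L x = c ⬝ᵥ x := by
    intro x
    conv_lhs => rw [← Finset.univ_sum_single x]
    rw [map_sum, dotProduct]
    refine Finset.sum_congr rfl fun j _ => ?_
    have : Pi.single j (x j) = (x j) • (Pi.single j 1 : Fin n → ℝ) := by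
      rw [← Pi.single_smul]; simp
    rw [this, map_smul, smul_eq_mul, mul_comm]
  rw [(charFunDual_centered hμ L).1, charFunDual_stdG_map T L c hc]
  have : (L : (Fin n → ℝ) → ℝ) = fun x => c ⬝ᵥ x := funext hc
  rw [this, hvar, ← hT, ← Matrix.mulVec_mulVec, dotProduct_mulVec, Matrix.mulVec_transpose]

lemma repr_lintegral {n : ℕ} {μ : Measure (Fin n → ℝ)} (hμ : IsCenteredGaussian μ) :
    ∃ (p : Fin n → Prop) (_ : DecidablePred p) (T : ({j // p j} → ℝ) →ₗ[ℝ] (Fin n → ℝ)),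
      ∀ F : (Fin n → ℝ) → ℝ≥0∞, ∫⁻ x, F x ∂μ = ∫⁻ y, F (T y) ∂(stdG {j // p j}) := by
  obtain ⟨p, hp, T, hinj, h⟩ := gauss_repr hμ
  refine ⟨p, hp, Matrix.mulVecLin T, fun F => ?_⟩
  have hcl : Topology.IsClosedEmbedding (Matrix.mulVecLin T) :=
    LinearMap.isClosedEmbedding_of_injective (LinearMap.ker_eq_bot.mpr hinj)
  have : μ = (stdG {j // p j}).map (Matrix.mulVecLin T) := h
  rw [this, hcl.measurableEmbedding.lintegral_map]

lemma qs_comp {n : ℕ} {κ : Type*} [Fintype κ] (T : (κ → ℝ) →ₗ[ℝ] (Fin n → ℝ))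
    {f : (Fin n → ℝ) → ℝ≥0∞} (hs : SymmetricFn f) (hq : QuasiConcaveFn f) :
    QS (fun y => f (T y)) := by
  intro c
  constructor
  · intro x hx y hy a b ha hb hab
    have hx' : T x ∈ {z | min (f (T x)) (f (T y)) ≤ f z} := min_le_left (f (T x)) (f (T y))
    have hy' : T y ∈ {z | min (f (T x)) (f (T y)) ≤ f z} := min_le_right (f (T x)) (f (T y))
    have h := hq (min (f (T x)) (f (T y))) hx' hy' ha hb hab
    have h2 : c < min (f (T x)) (f (T y)) := lt_min hx hy
    have h3 : min (f (T x)) (f (T y)) ≤ f (a • T x + b • T y) := h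
    show c < f (T (a • x + b • y))
    rw [map_add, map_smul, map_smul]
    exact h2.trans_le h3
  · intro x hx
    show c < f (T (-x))
    rw [map_neg, hs]
    exact hx

lemma qc_comp {n : ℕ} {κ : Type*} [Fintype κ] (T : (κ → ℝ) →ₗ[ℝ] (Fin n → ℝ))
    {f : (Fin n → ℝ) → ℝ≥0∞} (hs : SymmetricFn f) (hq : QuasiConvexFn f) (c : ℝ≥0∞) :
    SC {y | f (T y) ≤ c} := by
  constructor
  · exact (hq c).linear_preimage T
  · intro x hx
    show f (T (-x)) ≤ c
    rw [map_neg, hs]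
    exact hx

end Reduction

/-- Generalized Gaussian correlation inequalities. -/
theorem gaussian_correlation_inequalities :
    -- (1)
    (∀ (n : ℕ) (μ : Measure (Fin n → ℝ)), IsCenteredGaussian μ →
      ∀ (k : ℕ) (f : Fin (k + 1) → (Fin n → ℝ) → ℝ≥0∞),
        (∀ i, SymmetricFn (f i)) →
        (∀ i : Fin k, QuasiConcaveFn (f i.castSucc)) →
        QuasiConvexFn (f (Fin.last k)) →
        ∫⁻ x, ∏ i, f i x ∂μ ≤
          (∫⁻ x, ∏ i : Fin k, f i.castSucc x ∂μ) * ∫⁻ x, f (Fin.last k) x ∂μ) ∧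
    -- (2)
    (∀ (n : ℕ) (μ : Measure (Fin n → ℝ)), IsCenteredGaussian μ →
      ∀ (m k : ℕ) (f : Fin m → (Fin n → ℝ) → ℝ≥0∞),
        (∀ j, SymmetricFn (f j)) →
        (∀ j, QuasiConcaveFn (f j)) →
        -- a partition `{1,…,m} = J_1 ∪ ⋯ ∪ J_k` of the index set, given by its fibers
        ∀ J : Fin m → Fin k,
          ∏ i : Fin k, (∫⁻ x, ∏ j ∈ Finset.univ.filter (fun j => J j = i), f j x ∂μ) ≤
            ∫⁻ x, ∏ j, f j x ∂μ) := by
  constructor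
  · intro n μ hμ k f hs hq hc
    obtain ⟨p, hp, T, hT⟩ := repr_lintegral hμ
    simp_rw [hT, Fin.prod_univ_castSucc]
    exact compl_prod (fun (i : Fin k) y => f i.castSucc (T y))
      (fun i => qs_comp T (hs _) (hq i)) Finset.univ (fun y => f (Fin.last k) (T y))
      (fun c => qc_comp T (hs _) hc c)
  · intro n μ hμ m k f hs hq J
    obtain ⟨p, hp, T, hT⟩ := repr_lintegral hμ
    simp_rw [hT]
    have := many_prod (fun j y => f j (T y)) (fun j => qs_comp T (hs j) (hq j)) J Finset.univ
    simpa using this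

end GaussianCorrelation
end
end
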